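/- arXiv:1203.1911 — 2 statements merged into one kernel-verified Lean document; each statement's English description precedes it below -/
import Mathlib

section
/- Let q be a prime power and let H be a geometry over GF(q) with critical exponent c > 0. Then the limit as n → ∞ of ex_q(H; n) / ((q^n-1)/(q-1)) exists and equals 1 - q^{1-c}. -/
/-- Containment of geometries: `H`, a set of points of `PG(m-1,q)`, is contained in a set
`M` of points of `PG(n-1,q)` if some injective linear map `F^m → F^n` maps `H` into `M`. -/
def PGContains (F : Type) [Field F] (m n : ℕ)
    (H : Set (Projectivization F (Fin m → F)))
    (M : Set (Projectivization F (Fin n → F))) : Prop :=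
  ∃ (f : (Fin m → F) →ₗ[F] (Fin n → F)) (hf : Function.Injective f),
    ∀ x ∈ H, Projectivization.map f hf x ∈ M

/-- The rank of a set of points: the dimension of its linear span. -/
noncomputable def pgRank (F : Type) [Field F] (n : ℕ)
    (G : Set (Projectivization F (Fin n → F))) : ℕ :=
  Module.finrank F ↥(⨆ x ∈ G, x.submodule)

/-- The flat determined by a subspace `W`: all projective points lying in `W`. -/
def pgFlat (F : Type) [Field F] (n : ℕ) (W : Submodule F (Fin n → F)) :
    Set (Projectivization F (Fin n → F)) :=
  {x | x.submodule ≤ W}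

/-- The standard rank-`k` subspace of `F^m`: vectors vanishing on coordinates `≥ k`. -/
def stdSubspace (F : Type) [Field F] (m k : ℕ) : Submodule F (Fin m → F) :=
  LinearMap.ker (LinearMap.funLeft F F (fun i : {i : Fin m // k ≤ (i : ℕ)} => (i : Fin m)))

/-- `G(m-1,q,c)`: the points of `PG(m-1,q)` outside a rank-`(m-c)` flat. -/
def pgDel (F : Type) [Field F] (m c : ℕ) : Set (Projectivization F (Fin m → F)) :=
  {x | ¬ x.submodule ≤ stdSubspace F m (m - c)}

/-- `ex_q(H; n)`: the maximum size of a set of points of `PG(n-1,q)` not containing `H`. -/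
noncomputable def pgEx (F : Type) [Field F] (m : ℕ)
    (H : Set (Projectivization F (Fin m → F))) (n : ℕ) : ℕ :=
  sSup {k | ∃ M : Set (Projectivization F (Fin n → F)),
    ¬ PGContains F m n H M ∧ M.ncard = k}

/-- The critical exponent of a geometry `H`: the least `c` such that `H` is contained in
`G(r-1,q,c)`, where `r` is the rank of `H`. -/
noncomputable def critExp (F : Type) [Field F] (m : ℕ)
    (H : Set (Projectivization F (Fin m → F))) : ℕ :=
  sInf {c | PGContains F m (pgRank F m H) H (pgDel F (pgRank F m H) c)}


section Mean

variable {X Y Z : Type}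

/-- The average of a real-valued function on a finite type. -/
noncomputable def mean (f : X → ℝ) : ℝ := (∑ᶠ x, f x) / Nat.card X

/-- The density of a set in a finite type. -/
noncomputable def dens (A : Set X) : ℝ := mean (A.indicator 1)

lemma mean_eq_expect [Fintype X] (f : X → ℝ) : mean f = Finset.univ.expect f := by
  rw [mean, finsum_eq_sum_of_fintype, Nat.card_eq_fintype_card, Fintype.expect_eq_sum_div_card]

lemma mean_eq_sum [Fintype X] (f : X → ℝ) : mean f = (∑ x, f x) / Nat.card X := by
  rw [mean, finsum_eq_sum_of_fintype]

lemma mean_equiv (e : X ≃ Y) (f : Y → ℝ) : mean (fun x => f (e x)) = mean f := by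
  rw [mean, mean, Nat.card_congr e, finsum_comp_equiv]

lemma mean_add [Finite X] (f g : X → ℝ) : mean (fun x => f x + g x) = mean f + mean g := by
  cases nonempty_fintype X
  simp only [mean_eq_expect, Finset.expect_add_distrib]

lemma mean_sub [Finite X] (f g : X → ℝ) : mean (fun x => f x - g x) = mean f - mean g := by
  cases nonempty_fintype X
  simp only [mean_eq_expect, Finset.expect_sub_distrib]

lemma mean_const_mul [Finite X] (c : ℝ) (f : X → ℝ) : mean (fun x => c * f x) = c * mean f := by
  cases nonempty_fintype X
  simp only [mean_eq_expect, Finset.mul_expect]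

lemma mean_const [Finite X] [Nonempty X] (c : ℝ) : mean (fun _ : X => c) = c := by
  cases nonempty_fintype X
  simp only [mean_eq_expect, Fintype.expect_const]

lemma mean_mono [Finite X] {f g : X → ℝ} (h : ∀ x, f x ≤ g x) : mean f ≤ mean g := by
  cases nonempty_fintype X
  simp only [mean_eq_expect]
  exact Finset.expect_le_expect fun x _ => h x

lemma mean_nonneg [Finite X] {f : X → ℝ} (h : ∀ x, 0 ≤ f x) : 0 ≤ mean f := by
  cases nonempty_fintype X
  simp only [mean_eq_expect]
  exact Finset.expect_nonneg fun x _ => h x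

lemma mean_le [Finite X] [Nonempty X] {f : X → ℝ} {c : ℝ} (h : ∀ x, f x ≤ c) : mean f ≤ c :=
  (mean_mono h).trans_eq (mean_const c)

lemma le_mean [Finite X] [Nonempty X] {f : X → ℝ} {c : ℝ} (h : ∀ x, c ≤ f x) : c ≤ mean f :=
  (mean_const c).symm.trans_le (mean_mono h)

lemma exists_le_of_le_mean [Finite X] [Nonempty X] {f : X → ℝ} {c : ℝ} (h : c ≤ mean f) :
    ∃ x, c ≤ f x := by
  cases nonempty_fintype X
  rw [mean_eq_expect] at h
  obtain ⟨x, -, hx⟩ := Finset.exists_le_of_le_expect Finset.univ_nonempty h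
  exact ⟨x, hx⟩

lemma mean_prod [Finite X] [Finite Y] (f : X × Y → ℝ) :
    mean f = mean fun x => mean fun y => f (x, y) := by
  cases nonempty_fintype X
  cases nonempty_fintype Y
  simp only [mean_eq_expect]
  rw [← Finset.univ_product_univ, Finset.expect_product]

lemma mean_comm [Finite X] [Finite Y] (f : X → Y → ℝ) :
    (mean fun x => mean fun y => f x y) = mean fun y => mean fun x => f x y := by
  cases nonempty_fintype X
  cases nonempty_fintype Y
  simp only [mean_eq_expect]
  exact Finset.expect_comm ..

lemma dens_nonneg [Finite X] (A : Set X) : 0 ≤ dens A :=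
  mean_nonneg fun _ => Set.indicator_nonneg (fun _ _ => zero_le_one) _

lemma dens_le_one [Finite X] [Nonempty X] (A : Set X) : dens A ≤ 1 :=
  mean_le fun _ => Set.indicator_le_self' (fun _ _ => zero_le_one) _

lemma dens_mono [Finite X] {A B : Set X} (h : A ⊆ B) : dens A ≤ dens B :=
  mean_mono fun _ => Set.indicator_le_indicator_of_subset h (fun _ => zero_le_one) _

lemma dens_univ [Finite X] [Nonempty X] : dens (Set.univ : Set X) = 1 := by
  rw [dens, Set.indicator_univ]
  exact mean_const 1

lemma dens_eq_ncard [Finite X] (A : Set X) : dens A = A.ncard / Nat.card X := by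
  classical
  cases nonempty_fintype X
  rw [dens, mean_eq_sum, Finset.sum_indicator_eq_sum_filter]
  simp [Set.ncard_eq_toFinset_card']

lemma dens_compl [Finite X] [Nonempty X] (A : Set X) : dens Aᶜ = 1 - dens A := by
  rw [dens, dens, ← mean_const (X := X) 1, ← mean_sub]
  congr 1
  ext x
  by_cases h : x ∈ A <;> simp [h]

lemma dens_preimage_equiv (e : X ≃ Y) (A : Set Y) : dens (e ⁻¹' A) = dens A :=
  mean_equiv e (A.indicator 1)

/-- If every section of density at least `δ / 2` contains one of finitely many configurations,
then a set of density `δ` contains a fixed configuration in a positive proportion of sections. -/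
lemma exists_common_configuration {C : Type} [Finite X] [Finite Y] [Finite C] [Nonempty X]
    [Nonempty Y] {δ : ℝ} (hδ : 0 < δ) (conf : C → Set X) (A : X → Y → Prop)
    (h : ∀ y, δ / 2 ≤ dens {x | A x y} → ∃ c, ∀ x ∈ conf c, A x y)
    (hA : δ ≤ mean fun y => dens {x | A x y}) :
    ∃ c, δ / (2 * Nat.card C) ≤ dens {y | ∀ x ∈ conf c, A x y} := by
  classical
  cases nonempty_fintype C
  have key : δ / 2 ≤ ∑ c, dens {y | ∀ x ∈ conf c, A x y} := by
    have h1 : ∀ y, dens {x | A x y} - δ / 2 ≤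
        ∑ c, ({y | ∀ x ∈ conf c, A x y} : Set Y).indicator (1 : Y → ℝ) y := by
      intro y
      by_cases hy : δ / 2 ≤ dens {x | A x y}
      · obtain ⟨c, hc⟩ := h y hy
        have := Finset.single_le_sum (f := fun c =>
          ({y | ∀ x ∈ conf c, A x y} : Set Y).indicator (1 : Y → ℝ) y)
          (fun c _ => Set.indicator_nonneg (fun _ _ => zero_le_one) _) (Finset.mem_univ c)
        have h2 : ({y | ∀ x ∈ conf c, A x y} : Set Y).indicator (1 : Y → ℝ) y = 1 :=
          Set.indicator_of_mem (s := {y | ∀ x ∈ conf c, A x y}) hc _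
        have h3 := dens_le_one {x | A x y}
        simp only [h2] at this
        linarith
      · have : 0 ≤ ∑ c, ({y | ∀ x ∈ conf c, A x y} : Set Y).indicator (1 : Y → ℝ) y :=
          Finset.sum_nonneg fun c _ => Set.indicator_nonneg (fun _ _ => zero_le_one) _
        linarith
    have h4 := mean_mono h1
    rw [mean_sub, mean_const] at h4
    have h5 : (mean fun y => ∑ c, ({y | ∀ x ∈ conf c, A x y} : Set Y).indicator (1 : Y → ℝ) y)
        = ∑ c, dens {y | ∀ x ∈ conf c, A x y} := by
      cases nonempty_fintype Y
      simp only [dens, mean_eq_expect]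
      rw [Finset.expect_sum_comm]
    rw [h5] at h4
    linarith
  by_contra hcon
  push Not at hcon
  rcases isEmpty_or_nonempty C with hC | hC
  · simp at key
    linarith
  have h6 := Finset.sum_lt_sum_of_nonempty (Finset.univ_nonempty (α := C)) fun c _ => hcon c
  have h7 : (0 : ℝ) < Nat.card C := by exact_mod_cast Nat.card_pos
  rw [Finset.sum_const, Finset.card_univ, ← Nat.card_eq_fintype_card, nsmul_eq_mul] at h6
  have h8 : (Nat.card C : ℝ) * (δ / (2 * Nat.card C)) = δ / 2 := by field_simp
  linarith

end Mean

namespace Combinatorics.Subspace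

variable {α η ι κ : Type}

instance [Finite α] [Finite η] [Finite ι] : Finite (Subspace η α ι) :=
  Finite.of_injective idxFun fun _ _ => Subspace.ext

/-- The composition of two combinatorial subspaces. -/
def comp (V : Subspace η α ι) (W : Subspace κ α η) : Subspace κ α ι where
  idxFun i := (V.idxFun i).elim .inl W.idxFun
  proper e := by
    obtain ⟨j, hj⟩ := W.proper e
    obtain ⟨i, hi⟩ := V.proper j
    exact ⟨i, by simp [hi, hj]⟩

lemma comp_apply (V : Subspace η α ι) (W : Subspace κ α η) (x : κ → α) :
    V.comp W x = V (W x) := by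
  ext i
  cases h : V.idxFun i <;> simp [comp, apply_def, h]

/-- The subspace with free coordinates `η` and remaining coordinates given by `y`. -/
def fixRight (e : ι ≃ η ⊕ κ) (y : κ → α) : Subspace η α ι where
  idxFun i := (e i).elim .inr (.inl ∘ y)
  proper j := ⟨e.symm (.inl j), by simp⟩

lemma fixRight_apply (e : ι ≃ η ⊕ κ) (y : κ → α) (x : η → α) :
    fixRight e y x = Sum.elim x y ∘ e := by
  ext i
  cases h : e i <;> simp [fixRight, apply_def, h]

/-- The subspace with free coordinates `κ` and remaining coordinates given by `x`. -/
def fixLeft (e : ι ≃ η ⊕ κ) (x : η → α) : Subspace κ α ι where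
  idxFun i := (e i).elim (.inl ∘ x) .inr
  proper j := ⟨e.symm (.inr j), by simp⟩

lemma fixLeft_apply (e : ι ≃ η ⊕ κ) (x : η → α) (y : κ → α) :
    fixLeft e x y = Sum.elim x y ∘ e := by
  ext i
  cases h : e i <;> simp [fixLeft, apply_def, h]

lemma injective (V : Subspace η α ι) : Function.Injective V := by
  intro x y h
  ext e
  obtain ⟨i, hi⟩ := V.proper e
  simpa [apply_def, hi] using congrFun h i

end Combinatorics.Subspace

open Combinatorics

section Words

variable {α η ι κ : Type}

lemma exists_equiv_sum_fin (η ι : Type) [Finite η] [Finite ι] {N : ℕ}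
    (h : Nat.card η + N ≤ Nat.card ι) : ∃ k, N ≤ k ∧ Nonempty (ι ≃ η ⊕ Fin k) := by
  refine ⟨Nat.card ι - Nat.card η, by omega, ?_⟩
  rw [← Finite.card_eq, Nat.card_sum, Nat.card_fin]
  omega

lemma mean_words_split [Finite α] [Finite η] [Finite κ] (e : ι ≃ η ⊕ κ) (f : (ι → α) → ℝ) :
    mean f = mean fun x : η → α => mean fun y : κ → α => f (Sum.elim x y ∘ e) := by
  rw [← mean_prod (fun p : (η → α) × (κ → α) => f (Sum.elim p.1 p.2 ∘ e))]
  rw [← mean_equiv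
    ((Equiv.sumArrowEquivProdArrow η κ α).symm.trans (e.arrowCongr (Equiv.refl α)).symm)]
  rfl

/-- In a large enough space one finds a block `η` of coordinates, after fixing some coordinates,
all of whose sections have average at least the global average minus `ε`. -/
lemma exists_uniform_sections (α η : Type) [Finite α] [Nonempty α] [Finite η] {ε : ℝ}
    (hε : 0 < ε) : ∃ N, ∀ (ι : Type) [Finite ι], N ≤ Nat.card ι → ∀ f : (ι → α) → ℝ,
      (∀ x, 0 ≤ f x) → (∀ x, f x ≤ 1) →
      ∃ (k : ℕ) (V : (Fin k → α) → Subspace η α ι),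
        ∀ x, mean f - ε ≤ mean fun y => f (V y x) := by
  set c : ℝ := ε / Nat.card (η → α) with hc
  have hcard : (0 : ℝ) < Nat.card (η → α) := by exact_mod_cast Nat.card_pos
  have hc0 : 0 < c := by positivity
  have main : ∀ t : ℕ, ∀ (ι : Type) [Finite ι], t * Nat.card η ≤ Nat.card ι →
      ∀ f : (ι → α) → ℝ, (∀ x, f x ≤ 1) → 1 - t * c < mean f →
      ∃ (k : ℕ) (V : (Fin k → α) → Subspace η α ι),
        ∀ x, mean f - ε ≤ mean fun y => f (V y x) := by
    intro t
    induction t with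
    | zero =>
      intro ι _ _ f hf1 hf
      have := mean_le hf1
      simp at hf
      linarith
    | succ t ih =>
      intro ι _ hι f hf1 hf
      obtain ⟨k, hk, ⟨e⟩⟩ := exists_equiv_sum_fin η ι (N := t * Nat.card η) (by linarith)
      by_cases hgood : ∀ x : η → α, mean f - ε ≤ mean fun y => f (Subspace.fixRight e y x)
      · exact ⟨k, _, hgood⟩
      push Not at hgood
      obtain ⟨x₀, hx₀⟩ := hgood
      obtain ⟨x, hx⟩ : ∃ x : η → α, mean f + c ≤ mean fun y => f (Subspace.fixLeft e x y) := by
        by_contra hcon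
        push Not at hcon
        cases nonempty_fintype (η → α)
        have h1 := mean_words_split e f
        simp only [← Subspace.fixLeft_apply] at h1
        simp only [Subspace.fixRight_apply, ← Subspace.fixLeft_apply] at hx₀
        rw [mean_eq_sum (X := η → α), eq_div_iff hcard.ne'] at h1
        classical
        rw [← Finset.add_sum_erase _ _ (Finset.mem_univ x₀)] at h1
        have h2 := Finset.sum_le_sum (s := Finset.univ.erase x₀) fun x _ => (hcon x).le
        rw [Finset.sum_const, Finset.card_erase_of_mem (Finset.mem_univ _), Finset.card_univ,
          ← Nat.card_eq_fintype_card, nsmul_eq_mul, Nat.cast_sub Nat.card_pos] at h2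
        have h3 : (Nat.card (η → α) : ℝ) * c = ε := by rw [hc]; field_simp
        push_cast at h2
        nlinarith
      obtain ⟨l, V, hV⟩ := ih (Fin k) (by simpa using hk) (fun y => f (Subspace.fixLeft e x y))
        (fun _ => hf1 _) (by push_cast at hf; linarith)
      refine ⟨l, fun y => (Subspace.fixLeft e x).comp (V y), fun z => ?_⟩
      simp only [Subspace.comp_apply]
      linarith [hV z]
  obtain ⟨t, ht⟩ := exists_nat_gt (1 / c)
  refine ⟨t * Nat.card η, fun ι _ hι f hf0 hf1 => main t ι hι f hf1 ?_⟩
  rw [div_lt_iff₀ hc0] at ht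
  linarith [mean_nonneg hf0]

end Words

/-- The density Hales–Jewett property of an alphabet. -/
def DensityHalesJewett (α : Type) : Prop :=
  ∀ δ : ℝ, 0 < δ → ∃ N, ∀ (ι : Type) [Finite ι], N ≤ Nat.card ι → ∀ A : Set (ι → α),
    δ ≤ dens A → ∃ V : Subspace Unit α ι, ∀ x, V x ∈ A

section Multidimensional

variable {α : Type}

/-- The combinatorial subspace spanned by a line and a subspace on complementary coordinates. -/
def Combinatorics.Subspace.lineProd {η ι κ κ' : Type} (e : ι ≃ κ ⊕ κ') (L : Subspace Unit α κ)
    (V : Subspace η α κ') : Subspace (Option η) α ι where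
  idxFun i := (e i).elim (fun j => (L.idxFun j).map id fun _ => none)
    (fun j => (V.idxFun j).map id some)
  proper o := by
    cases o with
    | none =>
      obtain ⟨i, hi⟩ := L.proper ()
      exact ⟨e.symm (.inl i), by simp [hi]⟩
    | some j =>
      obtain ⟨i, hi⟩ := V.proper j
      exact ⟨e.symm (.inr i), by simp [hi]⟩

lemma Combinatorics.Subspace.lineProd_apply {η ι κ κ' : Type} (e : ι ≃ κ ⊕ κ')
    (L : Subspace Unit α κ) (V : Subspace η α κ') (x : Option η → α) :
    L.lineProd e V x = Sum.elim (L fun _ => x none) (V fun j => x (some j)) ∘ e := by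
  ext i
  rcases h : e i with j | j
  · cases h' : L.idxFun j <;> simp [lineProd, apply_def, h, h']
  · cases h' : V.idxFun j <;> simp [lineProd, apply_def, h, h']

lemma DensityHalesJewett.exists_subspace [Finite α] [Nonempty α] (H : DensityHalesJewett α)
    (η : Type) [Finite η] : ∀ δ : ℝ, 0 < δ → ∃ N, ∀ (ι : Type) [Finite ι], N ≤ Nat.card ι →
      ∀ A : Set (ι → α), δ ≤ dens A → ∃ V : Subspace η α ι, ∀ x, V x ∈ A := by
  induction η using Finite.induction_empty_option with
  | of_equiv e ih =>
    intro δ hδ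
    obtain ⟨N, hN⟩ := ih δ hδ
    refine ⟨N, fun ι _ hι A hA => ?_⟩
    obtain ⟨V, hV⟩ := hN ι hι A hA
    refine ⟨V.reindex e (Equiv.refl _) (Equiv.refl _), fun x => ?_⟩
    convert hV (x ∘ e) using 1
    ext i
    simp
  | h_empty =>
    intro δ hδ
    refine ⟨0, fun ι _ _ A hA => ?_⟩
    obtain ⟨x, hx⟩ := exists_le_of_le_mean hA
    have hxA : x ∈ A := by
      by_contra h
      rw [Set.indicator_of_notMem h] at hx
      linarith
    refine ⟨⟨fun i => .inl (x i), fun e => e.elim⟩, fun _ => ?_⟩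
    exact hxA
  | h_option ih =>
    rename_i η _
    intro δ hδ
    obtain ⟨m, hm⟩ := H (δ / 2) (by linarith)
    let C := Subspace Unit α (Fin m)
    obtain ⟨N, hN⟩ : ∃ N, Nonempty C → ∀ (ι : Type) [Finite ι], N ≤ Nat.card ι →
      ∀ A : Set (ι → α), δ / (2 * Nat.card C) ≤ dens A → ∃ V : Subspace η α ι, ∀ x, V x ∈ A := by
      rcases isEmpty_or_nonempty C with hC | hC
      · exact ⟨0, fun h => (h.some |> hC.elim)⟩
      · have : (0 : ℝ) < Nat.card C := by exact_mod_cast Nat.card_pos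
        obtain ⟨N, hN⟩ := ih (δ / (2 * Nat.card C)) (by positivity)
        exact ⟨N, fun _ => hN⟩
    refine ⟨m + N, fun ι _ hι A hA => ?_⟩
    obtain ⟨k, hk, ⟨e⟩⟩ := exists_equiv_sum_fin (Fin m) ι (N := N) (by simpa using hι)
    rw [dens, mean_words_split e, mean_comm] at hA
    obtain ⟨L, hL⟩ := exists_common_configuration hδ (fun L : C => Set.range L)
      (fun x (y : Fin k → α) => Sum.elim x y ∘ e ∈ A)
      (fun y hy => by
        obtain ⟨V, hV⟩ := hm (Fin m) (by simp) _ hy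
        exact ⟨V, by rintro _ ⟨x, rfl⟩; exact hV x⟩) hA
    obtain ⟨V, hV⟩ := hN ⟨L⟩ (Fin k) (by simpa using hk) _ hL
    refine ⟨L.lineProd e V, fun x => ?_⟩
    rw [Subspace.lineProd_apply]
    exact hV (fun j => x (some j)) _ ⟨_, rfl⟩

end Multidimensional

section Insensitive

variable {α ι κ : Type}

/-- Replace the letter `none` by `some a`. -/
def fillNone (a : α) (x : ι → Option α) : ι → Option α := fun i => some ((x i).getD a)

/-- A set of words is insensitive to interchanging the letters `none` and `some a`. -/
def Insensitive (a : α) (D : Set (ι → Option α)) : Prop := ∀ x, x ∈ D ↔ fillNone a x ∈ D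

lemma Insensitive.compl {a : α} {D : Set (ι → Option α)} (h : Insensitive a D) :
    Insensitive a Dᶜ := fun x => not_congr (h x)

lemma fillNone_subspace_fillNone (a : α) (V : Subspace κ (Option α) ι) (x : κ → Option α) :
    fillNone a (V (fillNone a x)) = fillNone a (V x) := by
  ext i : 1
  cases h : V.idxFun i <;> simp [fillNone, Subspace.apply_def, h]

lemma Insensitive.preimage {a : α} {D : Set (ι → Option α)} (h : Insensitive a D)
    (V : Subspace κ (Option α) ι) : Insensitive a (V ⁻¹' D) := fun x => by
  rw [Set.mem_preimage, Set.mem_preimage, h, h (V (fillNone a x)), fillNone_subspace_fillNone]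

/-- Extend a combinatorial subspace to a larger alphabet. -/
def Combinatorics.Subspace.mapSome (W : Subspace κ α ι) : Subspace κ (Option α) ι where
  idxFun i := (W.idxFun i).map some id
  proper e := by
    obtain ⟨i, hi⟩ := W.proper e
    exact ⟨i, by simp [hi]⟩

lemma fillNone_mapSome (a : α) (W : Subspace κ α ι) (x : κ → Option α) :
    fillNone a (W.mapSome x) = fun i => some (W (fun j => (x j).getD a) i) := by
  ext i : 1
  cases h : W.idxFun i <;> simp [fillNone, Subspace.mapSome, Subspace.apply_def, h]

lemma exists_subspace_of_insensitive [Finite α] [Nonempty α] (H : DensityHalesJewett α) (a : α)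
    (η : Type) [Finite η] {ε : ℝ} (hε : 0 < ε) : ∃ N, ∀ (ι : Type) [Finite ι], N ≤ Nat.card ι →
      ∀ D : Set (ι → Option α), Insensitive a D → ε ≤ dens D →
        ∃ V : Subspace η (Option α) ι, ∀ x, V x ∈ D := by
  obtain ⟨m, hm⟩ := H.exists_subspace η (ε / 2) (by linarith)
  obtain ⟨N, hN⟩ := exists_uniform_sections (Option α) (Fin m) (half_pos hε)
  refine ⟨N, fun ι _ hι D hD hεD => ?_⟩
  obtain ⟨k, V, hV⟩ := hN ι hι (D.indicator 1)
    (fun _ => Set.indicator_nonneg (fun _ _ => zero_le_one) _)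
    (fun _ => Set.indicator_le_self' (fun _ _ => zero_le_one) _)
  have h1 : ε / 2 ≤ mean fun x : Fin m → α => mean fun y =>
      D.indicator (1 : (ι → Option α) → ℝ) (V y fun i => some (x i)) :=
    le_mean fun x => by
      have := hV fun i => some (x i)
      have h2 : ε ≤ mean (D.indicator 1) := hεD
      linarith
  rw [mean_comm] at h1
  obtain ⟨y, hy⟩ := exists_le_of_le_mean h1
  obtain ⟨W, hW⟩ := hm (Fin m) (by simp) {x | V y (fun i => some (x i)) ∈ D} hy
  refine ⟨(V y).comp W.mapSome, fun x => ?_⟩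
  rw [Subspace.comp_apply]
  refine (hD.preimage (V y) _).2 ?_
  rw [fillNone_mapSome]
  exact hW _

lemma mean_indicator_le_dens {X : Type} [Finite X] {g : X → ℝ} (hg : ∀ x, g x ≤ 1)
    (D : Set X) : mean (D.indicator g) ≤ dens D :=
  mean_mono fun x => by
    by_cases h : x ∈ D <;> simp [h, hg]

lemma mean_indicator_split {X Y : Type} [Finite X] [Finite Y] (D : X → Set Y) (B : Set X)
    (E : Set Y) (hsub : ∀ x ∈ B, ∀ y ∈ E, y ∈ D x) (f : X → Y → ℝ) :
    (mean fun x => mean ((D x).indicator (f x))) =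
      mean (fun y => E.indicator 1 y * mean (B.indicator fun x => f x y)) +
      mean fun x => mean ((D x ∩ {y | x ∈ B → y ∉ E}).indicator (f x)) := by
  have hsplit : ∀ x y, (D x).indicator (f x) y = E.indicator 1 y * B.indicator (fun x => f x y) x +
      (D x ∩ {y | x ∈ B → y ∉ E}).indicator (f x) y := by
    intro x y
    have h2 := hsub x
    by_cases hx : x ∈ B <;> by_cases hy : y ∈ E <;> by_cases h3 : y ∈ D x <;> simp_all
  calc (mean fun x => mean ((D x).indicator (f x)))
      = mean fun x => mean fun y => E.indicator 1 y * B.indicator (fun x => f x y) x +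
        (D x ∩ {y | x ∈ B → y ∉ E}).indicator (f x) y := by simp only [← hsplit]
    _ = _ := by
      simp only [mean_add]
      rw [mean_comm]
      simp only [mean_const_mul]

/-- If the average of `g ≤ 1` is nonpositive on all subspaces of a given dimension, then `g` has
small integral over any insensitive set. -/
lemma mean_indicator_le_of_insensitive [Finite α] [Nonempty α] (H : DensityHalesJewett α) (a : α)
    (η : Type) [Finite η] {ε₀ : ℝ} (hε₀ : 0 < ε₀) : ∃ N, ∀ (ι : Type) [Finite ι], N ≤ Nat.card ι →
      ∀ g : (ι → Option α) → ℝ, (∀ x, g x ≤ 1) →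
      (∀ V : Subspace η (Option α) ι, mean (fun x => g (V x)) ≤ 0) →
      ∀ D : Set (ι → Option α), Insensitive a D → mean (D.indicator g) ≤ ε₀ := by
  obtain ⟨ε, rfl⟩ : ∃ ε, ε₀ = 2 * ε := ⟨ε₀ / 2, by ring⟩
  have hε : 0 < ε := by linarith
  obtain ⟨m, hm⟩ := exists_subspace_of_insensitive H a η (half_pos hε)
  let C := Subspace η (Option α) (Fin m)
  let X := Fin m → Option α
  have hX : (0 : ℝ) < Nat.card X := by exact_mod_cast Nat.card_pos
  set β : ℝ := ε / (2 * Nat.card C) with hβ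
  set c : ℝ := β / Nat.card X with hc
  have hβ0 : 0 ≤ β := by positivity
  have main : ∀ t : ℕ, ∀ (ι : Type) [Finite ι], t * m ≤ Nat.card ι →
      ∀ g : (ι → Option α) → ℝ, (∀ x, g x ≤ 1) →
      (∀ V : Subspace η (Option α) ι, mean (fun x => g (V x)) ≤ 0) →
      ∀ D : Set (ι → Option α), Insensitive a D →
        mean (D.indicator g) ≤ ε + (max 0 (1 - c)) ^ t * dens D := by
    intro t
    induction t with
    | zero =>
      intro ι _ _ g hg _ D _
      have := mean_indicator_le_dens hg D
      simp
      linarith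
    | succ t ih =>
      intro ι _ hι g hg hV D hD
      by_cases hDε : dens D ≤ ε
      · have := mean_indicator_le_dens hg D
        have := dens_nonneg D
        have : 0 ≤ (max 0 (1 - c)) ^ (t + 1) * dens D := by positivity
        linarith
      push Not at hDε
      obtain ⟨k, hk, ⟨e⟩⟩ := exists_equiv_sum_fin (Fin m) ι (N := t * m) (by simp; linarith)
      have hDX : dens D = mean fun x : X => dens (Subspace.fixLeft e x ⁻¹' D) := by
        rw [dens, mean_words_split e]
        simp only [← Subspace.fixLeft_apply]
        rfl
      have hDY : dens D = mean fun y => dens (Subspace.fixRight e y ⁻¹' D) := by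
        rw [dens, mean_words_split e, mean_comm]
        simp only [← Subspace.fixRight_apply]
        rfl
      obtain ⟨U, hU⟩ := exists_common_configuration hε (fun U : C => Set.range U)
        (fun x (y : Fin k → Option α) => Subspace.fixRight e y x ∈ D)
        (fun y hy => by
          obtain ⟨V, hV⟩ := hm (Fin m) (by simp) _ (hD.preimage (Subspace.fixRight e y)) hy
          exact ⟨V, by rintro _ ⟨x, rfl⟩; exact hV x⟩) (hDε.le.trans hDY.le)
      set E : Set (Fin k → Option α) := {y | ∀ x ∈ Set.range U, Subspace.fixRight e y x ∈ D}
        with hE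
      have hflip : ∀ (x : X) (y : Fin k → Option α),
          Subspace.fixRight e y x = Subspace.fixLeft e x y := fun x y => by
        rw [Subspace.fixRight_apply, Subspace.fixLeft_apply]
      have hEins : Insensitive a E := fun y => by
        refine forall₂_congr fun x _ => ?_
        rw [hflip, hflip]
        exact hD.preimage (Subspace.fixLeft e x) y
      -- the residual set in each section
      let R : X → Set (Fin k → Option α) := fun x =>
        (Subspace.fixLeft e x ⁻¹' D) ∩ {y | x ∈ Set.range U → y ∉ E}
      have hR : ∀ x, Insensitive a (R x) := fun x y =>
        and_congr (hD.preimage _ y) (imp_congr Iff.rfl (not_congr (hEins y)))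
      have hsub : ∀ x ∈ Set.range U, ∀ y ∈ E, Subspace.fixLeft e x y ∈ D := fun x hx y hy => by
        rw [← hflip]
        exact hy x hx
      have hmean : ∀ f : (ι → Option α) → ℝ, mean (D.indicator f) =
          mean (fun y => E.indicator 1 y *
            mean ((Set.range U).indicator fun x => f (Subspace.fixRight e y x))) +
          mean fun x => mean ((R x).indicator fun y => f (Subspace.fixLeft e x y)) := by
        intro f
        rw [mean_words_split e]
        simp only [hflip, ← Subspace.fixLeft_apply]
        exact mean_indicator_split (fun x => Subspace.fixLeft e x ⁻¹' D) (Set.range U) E hsub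
          fun x y => f (Subspace.fixLeft e x y)
      have hrange : ∀ f : X → ℝ, mean ((Set.range U).indicator f) =
          (∑ᶠ z, f (U z)) / Nat.card X := by
        intro f
        rw [mean, ← finsum_mem_def, finsum_mem_range U.injective]
      have hrange0 : ∀ y, mean ((Set.range U).indicator fun x => g (Subspace.fixRight e y x))
          ≤ 0 := by
        intro y
        rw [hrange]
        have h1 := hV ((Subspace.fixRight e y).comp U)
        simp only [Subspace.comp_apply] at h1
        have h2 : (0 : ℝ) < Nat.card (η → Option α) := by exact_mod_cast Nat.card_pos
        rw [mean, div_le_iff₀ h2, zero_mul] at h1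
        exact div_nonpos_of_nonpos_of_nonneg h1 hX.le
      have hrange1 : 1 / (Nat.card X : ℝ) ≤ mean ((Set.range U).indicator (1 : X → ℝ)) := by
        cases nonempty_fintype (η → Option α)
        rw [hrange, finsum_eq_sum_of_fintype]
        gcongr
        simp [Nat.one_le_iff_ne_zero]
      have hgle := hmean g
      have h1 : mean (fun y => E.indicator 1 y *
            mean ((Set.range U).indicator fun x => g (Subspace.fixRight e y x))) ≤ 0 :=
        (mean_mono (g := fun _ => 0) fun y => mul_nonpos_of_nonneg_of_nonpos
          (Set.indicator_nonneg (fun _ _ => zero_le_one) _) (hrange0 y)).trans_eq (mean_const 0)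
      have h2 : (mean fun x => mean ((R x).indicator fun y => g (Subspace.fixLeft e x y))) ≤
          mean fun x => ε + (max 0 (1 - c)) ^ t * dens (R x) :=
        mean_mono fun x => ih (Fin k) (by simpa using hk) _ (fun _ => hg _)
          (fun V => by
            have := hV ((Subspace.fixLeft e x).comp V)
            simpa only [Subspace.comp_apply] using this) _ (hR x)
      rw [mean_add, mean_const, mean_const_mul] at h2
      have h3 := hmean 1
      have h4 : c ≤ mean (fun y => E.indicator 1 y *
          mean ((Set.range U).indicator fun x => (1 : (ι → Option α) → ℝ)
            (Subspace.fixRight e y x))) := by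
        calc c = β * (1 / Nat.card X) := by rw [hc]; ring
          _ ≤ dens E * mean ((Set.range U).indicator (1 : X → ℝ)) := by
            gcongr
            exact dens_nonneg E
          _ = _ := by
            rw [mul_comm, dens, ← mean_const_mul]
            congr 1
            ext y
            rw [mul_comm]
            rfl
      have h5 : mean (fun x => dens (R x)) ≤ (1 - c) * dens D := by
        have h6 : dens D ≤ 1 := dens_le_one D
        have h7 : 0 ≤ c := by positivity
        have h8 : mean (D.indicator (1 : (ι → Option α) → ℝ)) = dens D := rfl
        have h9 : (mean fun x => mean ((R x).indicator fun y => (1 : (ι → Option α) → ℝ)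
            (Subspace.fixLeft e x y))) = mean fun x => dens (R x) := rfl
        nlinarith
      have h10 : (max 0 (1 - c)) ^ t * mean (fun x => dens (R x)) ≤
          (max 0 (1 - c)) ^ (t + 1) * dens D := by
        rw [pow_succ, mul_assoc]
        gcongr
        refine h5.trans ?_
        gcongr
        · exact dens_nonneg D
        · exact le_max_right _ _
      linarith
  rcases isEmpty_or_nonempty C with hC | hC
  · refine ⟨0, fun ι _ _ g hg _ D _ => ?_⟩
    have h1 : dens (Set.univ : Set X) < ε / 2 := by
      by_contra! h
      obtain ⟨V, -⟩ := hm (Fin m) (by simp) Set.univ (fun _ => Iff.rfl) h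
      exact hC.elim V
    rw [dens_univ] at h1
    linarith [mean_indicator_le_dens hg D, dens_le_one D]
  · have hC0 : (0 : ℝ) < Nat.card C := by exact_mod_cast Nat.card_pos
    have hc0 : 0 < c := by positivity
    obtain ⟨t, ht⟩ := exists_pow_lt_of_lt_one hε (max_lt one_pos (by linarith : 1 - c < 1))
    refine ⟨t * m, fun ι _ hι g hg hV D hD => ?_⟩
    have h1 := main t ι hι g hg hV D hD
    have h2 : (max 0 (1 - c)) ^ t * dens D ≤ ε * 1 := by
      gcongr
      · exact dens_nonneg D
      · exact dens_le_one D
    linarith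

end Insensitive

section DensityIncrement

variable {α : Type}

lemma mean_indicator_compl_iInter_le [Finite α] [Nonempty α] (H : DensityHalesJewett α)
    (s : Finset α) : ∀ (η : Type) [Finite η] (ε : ℝ), 0 < ε →
      ∃ N, ∀ (ι : Type) [Finite ι], N ≤ Nat.card ι →
      ∀ g : (ι → Option α) → ℝ, (∀ x, g x ≤ 1) →
      (∀ V : Subspace η (Option α) ι, mean (fun x => g (V x)) ≤ 0) →
      ∀ D : α → Set (ι → Option α), (∀ a, Insensitive a (D a)) →
        mean ((⋂ a ∈ s, D a)ᶜ.indicator g) ≤ ε := by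
  classical
  induction s using Finset.induction_on with
  | empty =>
    intro η _ ε hε
    refine ⟨0, fun ι _ _ g _ _ D _ => ?_⟩
    have : mean (fun _ : ι → Option α => (0 : ℝ)) = 0 := mean_const 0
    simpa [this] using hε.le
  | insert a s _ ih =>
    intro η _ ε hε
    have hε3 : 0 < ε / 3 := by positivity
    obtain ⟨N₁, h₁⟩ := ih η (ε / 3) hε3
    obtain ⟨N₂, h₂⟩ := mean_indicator_le_of_insensitive H a (Fin N₁) hε3
    obtain ⟨N₃, h₃⟩ := mean_indicator_le_of_insensitive H a η hε3
    refine ⟨max N₂ N₃, fun ι _ hι g hg hV D hD => ?_⟩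
    set D' := ⋂ b ∈ s, D b with hD'
    have hdecomp : ∀ x, (⋂ b ∈ insert a s, D b)ᶜ.indicator g x ≤ (D a)ᶜ.indicator g x +
        ((D a).indicator (fun x => D'ᶜ.indicator g x - ε / 3) x + ε / 3) := by
      intro x
      rw [Finset.set_biInter_insert]
      by_cases h1 : x ∈ D a <;> by_cases h2 : x ∈ D' <;> simp [h1, h2, ← hD'] <;> positivity
    have hle := mean_mono hdecomp
    rw [mean_add, mean_add, mean_const] at hle
    have hA := h₃ ι (le_of_max_le_right hι) g hg hV _ (hD a).compl
    have hB := h₂ ι (le_of_max_le_left hι) (fun x => D'ᶜ.indicator g x - ε / 3)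
      (fun x => by
        have : D'ᶜ.indicator g x ≤ 1 := Set.indicator_apply_le' (fun _ => hg x) fun _ => zero_le_one
        linarith)
      (fun V => by
        rw [mean_sub, mean_const]
        have := h₁ (Fin N₁) (by simp) (fun x => g (V x)) (fun x => hg _)
          (fun W => by
            have := hV (V.comp W)
            simpa only [Subspace.comp_apply] using this)
          (fun b => V ⁻¹' D b) (fun b => (hD b).preimage V)
        have heq : (fun x => D'ᶜ.indicator g (V x)) =
            (⋂ b ∈ s, V ⁻¹' D b)ᶜ.indicator fun x => g (V x) := by
          ext x
          simp only [Set.indicator_apply, hD', Set.mem_compl_iff, Set.mem_iInter, Set.mem_preimage]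
        rw [heq]
        linarith) _ (hD a)
    change _ ≤ _ + (mean ((D a).indicator _) + _) at hle
    change _ ≤ mean ((D a)ᶜ.indicator g) + _ at hle
    linarith

/-- A dense set admits a subspace on which it is almost as dense, and on which lines over the
smaller alphabet lie in the set with probability bounded below. -/
lemma exists_subspace_many_lines [Finite α] [Nonempty α] (H : DensityHalesJewett α) {δ₀ : ℝ}
    (hδ₀ : 0 < δ₀) (hδ₀1 : δ₀ ≤ 1) : ∃ θ : ℝ, 0 < θ ∧ ∀ ε : ℝ, 0 < ε → ∀ N : ℕ,
      ∃ N', ∀ (ι : Type) [Finite ι], N' ≤ Nat.card ι → ∀ A : Set (ι → Option α), ∀ δ : ℝ,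
        δ₀ ≤ δ → δ ≤ dens A → ∃ (κ : Type) (_ : Finite κ) (V : Subspace κ (Option α) ι),
          N ≤ Nat.card κ ∧
          δ - ε + δ * θ ≤ dens (V ⁻¹' A) + δ * dens {x | ∀ a, V (fillNone a x) ∈ A} := by
  obtain ⟨m, hm⟩ := H (δ₀ / 2 / 2) (by linarith)
  let C := Subspace Unit α (Fin m)
  have hC : Nonempty C := by
    obtain ⟨V, -⟩ := hm (Fin m) (by simp) Set.univ (by rw [dens_univ]; linarith)
    exact ⟨V⟩
  have hC0 : (0 : ℝ) < Nat.card C := by exact_mod_cast Nat.card_pos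
  refine ⟨δ₀ / 2 / (2 * Nat.card C), by positivity, fun ε hε N => ?_⟩
  set θ := δ₀ / 2 / (2 * Nat.card C)
  let B := Fin m × Fin N
  obtain ⟨N', hN'⟩ := exists_uniform_sections (Option α) B (lt_min hε (half_pos hδ₀))
  refine ⟨N', fun ι _ hι A δ hδ hA => ?_⟩
  obtain ⟨k, Φ, hΦ⟩ := hN' ι hι (A.indicator 1)
    (fun _ => Set.indicator_nonneg (fun _ _ => zero_le_one) _)
    (fun _ => Set.indicator_le_self' (fun _ _ => zero_le_one) _)
  have hΦ1 : ∀ x, δ - ε ≤ mean fun y => A.indicator (1 : (ι → Option α) → ℝ) (Φ y x) := fun x => by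
    have h1 := hΦ x
    have h2 := min_le_left ε (δ₀ / 2)
    change dens A - _ ≤ _ at h1
    linarith
  have hΦ2 : ∀ x, δ₀ / 2 ≤ mean fun y => A.indicator (1 : (ι → Option α) → ℝ) (Φ y x) := fun x => by
    have h1 := hΦ x
    have h2 := min_le_right ε (δ₀ / 2)
    change dens A - _ ≤ _ at h1
    linarith
  -- the word `x` with the letters `none` in block `j` replaced by `a j`
  let T : (Fin m → α) → (B → Option α) → (B → Option α) := fun a x b => some ((x b).getD (a b.1))
  obtain ⟨L, hL⟩ := exists_common_configuration (half_pos hδ₀)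
    (fun L : C => Set.range L)
    (fun a (p : (B → Option α) × (Fin k → Option α)) => Φ p.2 (T a p.1) ∈ A)
    (fun p hp => by
      obtain ⟨V, hV⟩ := hm (Fin m) (by simp) _ hp
      exact ⟨V, by rintro _ ⟨x, rfl⟩; exact hV x⟩)
    (by
      simp only [dens]
      rw [mean_comm]
      refine le_mean fun a => ?_
      rw [mean_prod]
      exact le_mean fun x => hΦ2 (T a x))
  let p : B → Prop := fun b => L.idxFun b.1 = .inr ()
  classical
  let e := (Equiv.piEquivPiSubtypeProd p (fun _ => Option α)).symm
  let κ := {b // p b}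
  let W : ({b // ¬ p b} → Option α) × (Fin k → Option α) → Subspace κ (Option α) ι :=
    fun w => (Φ w.2).comp
      ⟨fun b => if h : p b then .inr ⟨b, h⟩ else
        .inl (some ((w.1 ⟨b, h⟩).getD ((L.idxFun b.1).elim id fun _ => Classical.arbitrary α))),
        fun b => ⟨b.1, by simp [b.2]⟩⟩
  have hκ : N ≤ Nat.card κ := by
    obtain ⟨j, hj⟩ := L.proper ()
    have : Function.Injective (fun i : Fin N => (⟨(j, i), hj⟩ : κ)) := fun i i' h => by
      exact (Prod.ext_iff.1 (Subtype.ext_iff.1 h)).2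
    simpa using Nat.card_le_card_of_injective _ this
  have hlines : θ ≤ mean fun w => dens {x | ∀ a, W w (fillNone a x) ∈ A} := by
    let E : (({b // ¬ p b} → Option α) × (Fin k → Option α)) × (κ → Option α) ≃
        (B → Option α) × (Fin k → Option α) :=
      { toFun := fun q => (e (q.2, q.1.1), q.1.2)
        invFun := fun r => (((e.symm r.1).2, r.2), (e.symm r.1).1)
        left_inv := fun q => by simp
        right_inv := fun r => by simp }
    have hE : ∀ q a, W q.1 (fillNone a q.2) = Φ (E q).2 (T (L fun _ => a) (E q).1) := by
      rintro ⟨w, x⟩ a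
      simp only [W, Subspace.comp_apply]
      congr 1
      ext b : 1
      by_cases hb : p b
      · have hb' : L.idxFun b.1 = .inr () := hb
        simp [E, T, e, Subspace.apply_def, hb, hb', fillNone, Equiv.piEquivPiSubtypeProd]
      · rcases hb' : L.idxFun b.1 with c | c
        · simp [E, T, e, Subspace.apply_def, hb, hb', Equiv.piEquivPiSubtypeProd]
        · exact absurd hb' hb
    have h1 := dens_preimage_equiv E {p | ∀ z ∈ Set.range L, Φ p.2 (T z p.1) ∈ A}
    rw [← h1, dens, mean_prod] at hL
    refine hL.trans (mean_mono fun w => mean_mono fun x => ?_)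
    have hmem : E (w, x) ∈ {p | ∀ z ∈ Set.range L, Φ p.2 (T z p.1) ∈ A} →
        x ∈ {x | ∀ a, W w (fillNone a x) ∈ A} := fun hx a => by
      have h2 := hx (L fun _ => a) ⟨_, rfl⟩
      rw [← hE (w, x) a] at h2
      exact h2
    rw [Set.indicator_apply, Set.indicator_apply]
    split_ifs with h2 h3
    · exact le_rfl
    · exact absurd (hmem h2) h3
    · exact zero_le_one
    · exact le_rfl
  have hdens : δ - ε ≤ mean fun w => dens (W w ⁻¹' A) := by
    simp only [dens]
    rw [mean_comm]
    refine le_mean fun x => ?_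
    rw [mean_prod]
    refine le_mean fun w => ?_
    refine (hΦ1 fun b => if h : p b then x ⟨b, h⟩ else
      some ((w ⟨b, h⟩).getD ((L.idxFun b.1).elim id fun _ => Classical.arbitrary α))).trans_eq ?_
    congr 1
    ext y
    simp only [W, Set.indicator_apply, Set.mem_preimage, Subspace.comp_apply, Pi.one_apply]
    congr 3
    ext b : 1
    by_cases hb : p b <;> simp [Subspace.apply_def, hb]
  have hδ0 : 0 < δ := by linarith
  have hsum : δ - ε + δ * θ ≤
      mean fun w => dens (W w ⁻¹' A) + δ * dens {x | ∀ a, W w (fillNone a x) ∈ A} := by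
    rw [mean_add, mean_const_mul]
    nlinarith
  obtain ⟨w, hw⟩ := exists_le_of_le_mean hsum
  exact ⟨κ, inferInstance, W w, hκ, hw⟩

/-- The combinatorial line of all fillings of the letter `none` in a word. -/
def lineOfWord {ι : Type} (x : ι → Option α) (h : ∃ i, x i = none) :
    Subspace Unit (Option α) ι where
  idxFun i := (x i).elim (.inr ()) (fun a => .inl (some a))
  proper _ := h.imp fun i hi => by simp [hi]

lemma lineOfWord_none {ι : Type} (x : ι → Option α) (h : ∃ i, x i = none) :
    lineOfWord x h (fun _ => none) = x := by
  ext i : 1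
  cases hi : x i <;> simp [lineOfWord, Subspace.apply_def, hi]

lemma lineOfWord_some {ι : Type} (x : ι → Option α) (h : ∃ i, x i = none) (a : α) :
    lineOfWord x h (fun _ => some a) = fillNone a x := by
  ext i : 1
  cases hi : x i <;> simp [lineOfWord, Subspace.apply_def, hi, fillNone]

lemma dens_forall_ne_none {ι : Type} [Finite ι] [Finite α] :
    dens {x : ι → Option α | ∀ i, x i ≠ none} =
      ((Nat.card α : ℝ) / (Nat.card α + 1)) ^ Nat.card ι := by
  have h : {x : ι → Option α | ∀ i, x i ≠ none} = Set.range fun (y : ι → α) i => some (y i) := by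
    ext x
    constructor
    · intro hx
      choose y hy using fun i => Option.ne_none_iff_exists'.1 (hx i)
      exact ⟨y, funext fun i => (hy i).symm⟩
    · rintro ⟨y, rfl⟩ i
      simp
  have hinj : Function.Injective fun (y : ι → α) i => some (y i) := fun y z hyz =>
    funext fun i => Option.some_injective _ (congrFun hyz i)
  rw [h, dens_eq_ncard, ← Set.image_univ, Set.ncard_image_of_injective _ hinj, Set.ncard_univ,
    Nat.card_fun, Nat.card_fun, Finite.card_option, div_pow]
  push_cast
  rfl

lemma DensityHalesJewett.option [Finite α] [Nonempty α] (H : DensityHalesJewett α) :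
    DensityHalesJewett (Option α) := by
  by_contra hcon
  let P : ℝ → Prop := fun δ => ∃ N, ∀ (ι : Type) [Finite ι], N ≤ Nat.card ι →
    ∀ A : Set (ι → Option α), δ ≤ dens A → ∃ V : Subspace Unit (Option α) ι, ∀ x, V x ∈ A
  obtain ⟨δ₁, hδ₁, hnot⟩ : ∃ δ, 0 < δ ∧ ¬ P δ := by
    unfold DensityHalesJewett at hcon
    push Not at hcon
    obtain ⟨δ, h, h'⟩ := hcon
    exact ⟨δ, h, fun ⟨N, hN⟩ => by
      obtain ⟨ι, _, h1, A, h2, h3⟩ := h' N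
      obtain ⟨V, hV⟩ := hN ι h1 A h2
      obtain ⟨x, hx⟩ := h3 V
      exact hx (hV x)⟩
  have hup : ∀ δ δ', δ ≤ δ' → P δ → P δ' := fun δ δ' h ⟨N, hN⟩ =>
    ⟨N, fun ι _ hι A hA => hN ι hι A (h.trans hA)⟩
  have hbdd : ∀ δ, P δ → δ₁ ≤ δ := fun δ h => by
    by_contra! hlt
    exact hnot (hup _ _ hlt.le h)
  have htwo : P 2 := ⟨0, fun ι _ _ A hA => by linarith [dens_le_one A]⟩
  obtain ⟨δs, hδs⟩ := Real.exists_isGLB (s := {δ | P δ}) ⟨2, htwo⟩ ⟨δ₁, hbdd⟩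
  have hδs1 : δ₁ ≤ δs := hδs.2 hbdd
  have hδs0 : 0 < δs := by linarith
  obtain ⟨θ, hθ, hmany⟩ := exists_subspace_many_lines H (δ₀ := min (δs / 2) 1) (by positivity)
    (min_le_right _ _)
  set η : ℝ := min (δs * θ / 12) (δs / 2) with hη
  have hη0 : 0 < η := by positivity
  have hη1 : η ≤ δs * θ / 12 := min_le_left _ _
  have hη2 : η ≤ δs / 2 := min_le_right _ _
  have hlow : ¬ P (δs - η) := fun h => by linarith [hδs.1 h]
  obtain ⟨M, hM⟩ : P (δs + η) := by
    by_contra h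
    have : δs + η ≤ δs := hδs.2 fun δ hδ => by
      by_contra! hlt
      exact h (hup _ _ hlt.le hδ)
    linarith
  cases nonempty_fintype α
  obtain ⟨N₁, hN₁⟩ := mean_indicator_compl_iInter_le H Finset.univ (Fin M) η hη0
  obtain ⟨N₂, hN₂⟩ := exists_pow_lt_of_lt_one hη0
    (show (Nat.card α : ℝ) / (Nat.card α + 1) < 1 by rw [div_lt_one (by positivity)]; linarith)
  obtain ⟨N₃, hN₃⟩ := hmany η hη0 (max N₁ N₂)
  refine hlow ⟨N₃, fun ι _ hι A hA => ?_⟩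
  by_contra hline
  push Not at hline
  obtain ⟨κ, _, V, hκ, hV⟩ := hN₃ ι hι A (δs - η)
    ((min_le_left _ _).trans (by linarith)) hA
  set D : α → Set (κ → Option α) := fun a => {x | V (fillNone a x) ∈ A} with hD
  have hDins : ∀ a, Insensitive a (D a) := fun a x => by
    have : fillNone a (fillNone a x) = fillNone a x := rfl
    rw [hD, Set.mem_ofPred_eq, Set.mem_ofPred_eq, this]
  set A' := V ⁻¹' A with hA'
  set D' := ⋂ a ∈ Finset.univ, D a with hD'
  have hline' : ∀ L : Subspace Unit (Option α) κ, ∃ x, L x ∉ A' := fun L => by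
    obtain ⟨x, hx⟩ := hline (V.comp L)
    exact ⟨x, by rwa [Subspace.comp_apply] at hx⟩
  have hDp : {x | ∀ a, V (fillNone a x) ∈ A} = D' := by
    ext x
    simp [hD', hD]
  have hsmall : dens (A' ∩ D') ≤ η := by
    have h1 : A' ∩ D' ⊆ {x | ∀ i, x i ≠ none} := by
      rintro x ⟨hxA, hxD⟩ i hi
      rw [← hDp] at hxD
      obtain ⟨z, hz⟩ := hline' (lineOfWord x ⟨i, hi⟩)
      apply hz
      have hzc : z = fun _ => z () := rfl
      rw [hzc]
      cases z () with
      | none => rwa [lineOfWord_none]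
      | some a =>
        rw [lineOfWord_some]
        exact hxD a
    refine (dens_mono h1).trans ?_
    rw [dens_forall_ne_none]
    refine (pow_le_pow_of_le_one (by positivity) ?_ (le_of_max_le_right hκ)).trans hN₂.le
    rw [div_le_one (by positivity)]
    linarith
  have hg := hN₁ κ (le_of_max_le_left hκ) (fun x => A'.indicator 1 x - (δs + η))
    (fun x => by
      have : A'.indicator 1 x ≤ (1 : ℝ) := Set.indicator_le_self' (fun _ _ => zero_le_one) x
      linarith)
    (fun W => by
      rw [mean_sub, mean_const]
      by_contra! hlt
      obtain ⟨L, hL⟩ := hM (Fin M) (by simp) (W ⁻¹' A') (by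
        change _ ≤ mean fun x => A'.indicator 1 (W x)
        linarith)
      obtain ⟨x, hx⟩ := hline' (W.comp L)
      rw [Subspace.comp_apply] at hx
      exact hx (hL x))
    D hDins
  rw [← hD'] at hg
  have hsum : dens A' = mean (D'ᶜ.indicator fun x => A'.indicator 1 x - (δs + η)) +
      ((δs + η) * dens D'ᶜ + dens (A' ∩ D')) := by
    rw [dens, dens, dens, ← mean_const_mul, ← mean_add, ← mean_add]
    congr 1
    ext x
    by_cases h1 : x ∈ A' <;> by_cases h2 : x ∈ D' <;> simp [h1, h2]
  rw [hDp] at hV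
  rw [dens_compl] at hsum
  have hp := dens_nonneg D'
  have : (δs - η) * θ ≥ δs / 2 * θ := by gcongr; linarith
  have h3 : 0 < δs * θ := by positivity
  have h4 : 0 ≤ η * dens D' := by positivity
  nlinarith

lemma DensityHalesJewett.of_equiv {β : Type} (e : α ≃ β) (H : DensityHalesJewett α) :
    DensityHalesJewett β := by
  intro δ hδ
  obtain ⟨N, hN⟩ := H δ hδ
  refine ⟨N, fun ι _ hι A hA => ?_⟩
  obtain ⟨V, hV⟩ := hN ι hι (Equiv.arrowCongr (Equiv.refl ι) e ⁻¹' A)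
    (by rwa [dens_preimage_equiv])
  refine ⟨V.reindex (Equiv.refl _) e (Equiv.refl _), fun x => ?_⟩
  have := hV fun j => e.symm (x j)
  rw [Set.mem_preimage] at this
  convert this using 1
  ext i
  simp [Function.comp_def]

lemma densityHalesJewett_of_subsingleton [Subsingleton α] : DensityHalesJewett α := by
  intro δ hδ
  refine ⟨1, fun ι _ hι A hA => ?_⟩
  have : Nonempty ι := (Nat.card_pos_iff.1 hι).1
  refine ⟨⟨fun _ => .inr (), fun _ => ⟨Classical.arbitrary ι, rfl⟩⟩, fun x => ?_⟩
  by_contra hx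
  have hA0 : A = ∅ := by
    ext y
    rw [Subsingleton.elim y]
    simpa using hx
  rw [hA0, dens_eq_ncard] at hA
  simp at hA
  linarith

/-- The density Hales–Jewett theorem. -/
theorem densityHalesJewett (α : Type) [Finite α] [Nonempty α] : DensityHalesJewett α := by
  classical
  have key : ∀ (β : Type) [Finite β], DensityHalesJewett (Option β) := by
    intro β _
    induction β using Finite.induction_empty_option with
    | of_equiv e ih => exact ih.of_equiv (Equiv.optionCongr e)
    | h_empty => exact densityHalesJewett_of_subsingleton
    | h_option ih => exact ih.option
  exact (key {x : α // x ≠ Classical.arbitrary α}).of_equiv (Equiv.optionSubtypeNe _)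

end DensityIncrement

section Tuples

variable {F V : Type} [Field F] [Finite F] [AddCommGroup V] [Module F V] [Finite V]

lemma dens_iUnion_le {X ι : Type} [Finite X] [Finite ι] (A : ι → Set X) {δ : ℝ}
    (h : ∀ i, dens (A i) ≤ δ) : dens (⋃ i, A i) ≤ Nat.card ι * δ := by
  cases nonempty_fintype ι
  have h1 : ((⋃ i, A i).ncard : ℝ) ≤ ∑ i, ((A i).ncard : ℝ) := by
    have := Set.ncard_iUnion_le_of_fintype A
    exact_mod_cast this
  calc dens (⋃ i, A i) ≤ ∑ i, dens (A i) := by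
        simp only [dens_eq_ncard]
        rw [← Finset.sum_div]
        gcongr
    _ ≤ ∑ _i : ι, δ := Finset.sum_le_sum fun i _ => h i
    _ = Nat.card ι * δ := by simp

/-- The density of tuples all of whose nontrivial combinations lie in a dense set. -/
lemma pow_le_dens_tuples {T : Set V} (hT : ∀ a : F, a ≠ 0 → ∀ v ∈ T, a • v ∈ T) {c : ℕ}
    {ε : ℝ} (hε : 0 < ε) (hdens : 1 - ((Nat.card F : ℝ) ^ c)⁻¹ + ε ≤ dens T) :
    ∀ j ≤ c + 1, ε ^ j ≤ dens {u : Fin j → V | ∀ a : Fin j → F, a ≠ 0 → ∑ i, a i • u i ∈ T} := by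
  have hq : (1 : ℝ) ≤ Nat.card F := by exact_mod_cast Nat.card_pos
  intro j
  induction j with
  | zero =>
    intro _
    have : {u : Fin 0 → V | ∀ a : Fin 0 → F, a ≠ 0 → ∑ i, a i • u i ∈ T} = Set.univ := by
      ext u
      simp only [Set.mem_ofPred_eq, Set.mem_univ, iff_true]
      exact fun a ha => absurd (Subsingleton.elim _ _) ha
    rw [this, dens_univ, pow_zero]
  | succ j ih =>
    intro hj
    have hstep : ∀ u : Fin j → V, ε ≤ dens {v : V | ∀ s : Fin j → F, v + ∑ i, s i • u i ∈ T} := by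
      intro u
      have h1 : {v : V | ∀ s : Fin j → F, v + ∑ i, s i • u i ∈ T}ᶜ =
          ⋃ s : Fin j → F, Equiv.addRight (∑ i, s i • u i) ⁻¹' Tᶜ := by
        ext v
        simp
      have h2 := dens_iUnion_le (fun s : Fin j → F => Equiv.addRight (∑ i, s i • u i) ⁻¹' Tᶜ)
        fun s => (dens_preimage_equiv _ Tᶜ).le
      rw [← h1, dens_compl, dens_compl, Nat.card_fun, Nat.card_fin] at h2
      push_cast at h2
      have h3 : (Nat.card F : ℝ) ^ j ≤ (Nat.card F : ℝ) ^ c :=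
        pow_le_pow_right₀ hq (by omega)
      have h4 : (1 : ℝ) ≤ (Nat.card F : ℝ) ^ c := one_le_pow₀ hq
      have h5 := dens_le_one T
      have h6 : (Nat.card F : ℝ) ^ j * (1 - dens T) ≤ (Nat.card F : ℝ) ^ c * (1 - dens T) := by
        gcongr
      have h7 : (Nat.card F : ℝ) ^ c * (1 - dens T) ≤
          (Nat.card F : ℝ) ^ c * (((Nat.card F : ℝ) ^ c)⁻¹ - ε) := by
        exact mul_le_mul_of_nonneg_left (by linarith) (by positivity)
      rw [mul_sub _ (_⁻¹), mul_inv_cancel₀ (by positivity)] at h7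
      nlinarith
    have h1 := ih (by omega)
    rw [← dens_preimage_equiv (Fin.consEquiv fun _ : Fin (j + 1) => V), dens, mean_prod, mean_comm]
    calc ε ^ (j + 1) = ε * ε ^ j := by ring
      _ ≤ ε * dens {u : Fin j → V | ∀ a : Fin j → F, a ≠ 0 → ∑ i, a i • u i ∈ T} := by gcongr
      _ = mean fun u => ε * {u : Fin j → V | ∀ a : Fin j → F, a ≠ 0 →
          ∑ i, a i • u i ∈ T}.indicator 1 u := by rw [mean_const_mul]; rfl
      _ ≤ _ := mean_mono fun u => ?_
    by_cases hu : u ∈ {u : Fin j → V | ∀ a : Fin j → F, a ≠ 0 → ∑ i, a i • u i ∈ T}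
    · rw [Set.indicator_of_mem hu, Pi.one_apply, mul_one]
      refine (hstep u).trans (dens_mono fun v hv => ?_)
      intro a ha
      simp only [Fin.consEquiv_apply, Fin.sum_univ_succ, Fin.cons_zero, Fin.cons_succ]
      by_cases ha0 : a 0 = 0
      · rw [ha0, zero_smul, zero_add]
        refine hu (fun i => a i.succ) fun h => ha ?_
        ext i
        refine Fin.cases ha0 (fun i => congrFun h i) i
      · have := hT (a 0) ha0 _ (hv fun i => (a 0)⁻¹ * a i.succ)
        simpa [smul_add, Finset.smul_sum, smul_smul, mul_inv_cancel_left₀ ha0] using this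
    · rw [Set.indicator_of_notMem hu, mul_zero]
      exact mean_nonneg fun _ => Set.indicator_nonneg (fun _ _ => zero_le_one) _

/-- A dense scaling-invariant set of nonzero vectors contains the complement of a subspace of
codimension `c + 1` in some subspace of given dimension. -/
theorem exists_linearMap_mem_of_dens (F : Type) [Field F] [Finite F] (t c : ℕ) {ε : ℝ}
    (hε : 0 < ε) : ∃ N, ∀ n, N ≤ n → ∀ T : Set (Fin n → F), (0 : Fin n → F) ∉ T →
      (∀ a : F, a ≠ 0 → ∀ v ∈ T, a • v ∈ T) →
      1 - ((Nat.card F : ℝ) ^ c)⁻¹ + ε ≤ dens T →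
      ∃ f : ((Fin t → F) × (Fin (c + 1) → F)) →ₗ[F] (Fin n → F), Function.Injective f ∧
        ∀ b a, a ≠ 0 → f (b, a) ∈ T := by
  classical
  obtain ⟨N, hN⟩ := densityHalesJewett (Fin (c + 1) → Fin t → F) (ε ^ (c + 1)) (by positivity)
  refine ⟨N * t, fun n hn T h0 hT hdens => ?_⟩
  obtain ⟨k, -, ⟨e⟩⟩ := exists_equiv_sum_fin (Fin N × Fin t) (Fin n) (N := 0) (by simpa using hn)
  let Ψ : (Fin N → Fin (c + 1) → Fin t → F) × (Fin (c + 1) → Fin k → F) ≃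
      (Fin (c + 1) → Fin n → F) :=
    { toFun := fun p i => Sum.elim (fun z => p.1 z.1 i z.2) (p.2 i) ∘ e
      invFun := fun u => (fun j i s => u i (e.symm (.inl (j, s))), fun i l => u i (e.symm (.inr l)))
      left_inv := fun p => by simp
      right_inv := fun u => by
        ext i l
        obtain ⟨l, rfl⟩ := e.symm.surjective l
        rcases l with l | l <;> simp }
  have h1 := pow_le_dens_tuples hT hε hdens (c + 1) le_rfl
  rw [← dens_preimage_equiv Ψ, dens, mean_prod, mean_comm] at h1
  obtain ⟨r, hr⟩ := exists_le_of_le_mean h1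
  obtain ⟨L, hL⟩ := hN (Fin N) (by simp) {w | ∀ a : Fin (c + 1) → F, a ≠ 0 →
    ∑ i, a i • Ψ (w, r) i ∈ T} hr
  let u : Fin (c + 1) → Fin n → F := Ψ (L 0, r)
  let w : Fin t → Fin n → F := fun s =>
    Sum.elim (fun z => if L.idxFun z.1 = .inr () ∧ z.2 = s then 1 else 0) 0 ∘ e
  have hw : ∀ b : Fin t → F, ∀ l, (∑ s, b s • w s) l =
      Sum.elim (fun z => if L.idxFun z.1 = .inr () then b z.2 else 0) 0 (e l) := by
    intro b l
    rcases h : e l with z | z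
    · by_cases hz : L.idxFun z.1 = .inr () <;> simp [w, h, hz]
    · simp [w, h]
  have hΨ : ∀ x : Fin (c + 1) → Fin t → F, ∀ i,
      Ψ (L fun _ => x, r) i = u i + ∑ s, x i s • w s := by
    intro x i
    ext l
    rw [Pi.add_apply, hw]
    rcases h : e l with z | z
    · rcases hz : L.idxFun z.1 with y | y <;> simp [Ψ, u, h, hz, Subspace.apply_def]
    · simp [Ψ, u, h]
  have hmem : ∀ (b : Fin t → F) (a : Fin (c + 1) → F), a ≠ 0 →
      ∑ s, b s • w s + ∑ i, a i • u i ∈ T := by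
    intro b a ha
    obtain ⟨i, hi⟩ := Function.ne_iff.1 ha
    have hi' : a i ≠ 0 := hi
    have h2 := hL (fun _ => Pi.single i fun s => (a i)⁻¹ * b s) a ha
    convert h2 using 1
    simp only [hΨ, smul_add, Finset.sum_add_distrib]
    rw [add_comm, add_right_inj, Finset.sum_eq_single i]
    · simp [Finset.smul_sum, smul_smul, mul_inv_cancel_left₀ hi']
    · intro l _ hl
      simp [hl]
    · simp
  refine ⟨(Fintype.linearCombination F w).coprod (Fintype.linearCombination F u), ?_, ?_⟩
  · rw [← LinearMap.ker_eq_bot, LinearMap.ker_eq_bot']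
    rintro ⟨b, a⟩ hba
    simp only [LinearMap.coprod_apply, Fintype.linearCombination_apply] at hba
    have ha : a = 0 := by
      by_contra ha
      exact h0 (hba ▸ hmem b a ha)
    have hb : b = 0 := by
      obtain ⟨j, hj⟩ := L.proper ()
      ext s
      have h3 := hw b (e.symm (.inl (j, s)))
      simp only [ha, Pi.zero_apply, zero_smul, Finset.sum_const_zero, add_zero] at hba
      rw [hba] at h3
      simpa [hj] using h3.symm
    rw [ha, hb]
    rfl
  · intro b a ha
    simpa [Fintype.linearCombination_apply] using hmem b a ha

end Tuples

section Geometry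

variable {F : Type} [Field F]

/-- The nonzero vectors representing the points of a geometry. -/
def pgCone {n : ℕ} (M : Set (Projectivization F (Fin n → F))) : Set (Fin n → F) :=
  {v | ∃ h : v ≠ 0, Projectivization.mk F v h ∈ M}

lemma ncard_pgCone {n : ℕ} (M : Set (Projectivization F (Fin n → F))) :
    (pgCone M).ncard = M.ncard * (Nat.card F - 1) := by
  have himage : pgCone M =
      (fun p : Projectivization F (Fin n → F) × Fˣ => p.2 • p.1.rep) '' M ×ˢ Set.univ := by
    ext v
    constructor
    · rintro ⟨h, hv⟩
      obtain ⟨a, ha⟩ := Projectivization.exists_smul_eq_mk_rep F v h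
      exact ⟨(_, a⁻¹), ⟨hv, trivial⟩, by
        change a⁻¹ • (Projectivization.mk F v h).rep = v
        rw [← ha, inv_smul_smul]⟩
    · rintro ⟨⟨x, a⟩, ⟨hx, -⟩, rfl⟩
      refine ⟨(smul_ne_zero_iff_ne a).2 x.rep_nonzero, ?_⟩
      convert hx
      rw [← x.mk_rep, Projectivization.mk_eq_mk_iff]
      exact ⟨a, by simp [x.mk_rep]⟩
  have hinj : Function.Injective
      fun p : Projectivization F (Fin n → F) × Fˣ => p.2 • p.1.rep := by
    rintro ⟨x, a⟩ ⟨y, b⟩ h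
    have h : a • x.rep = b • y.rep := h
    have hxy : x = y := by
      rw [← x.mk_rep, ← y.mk_rep, Projectivization.mk_eq_mk_iff]
      exact ⟨a⁻¹ * b, by rw [mul_smul, ← h, inv_smul_smul]⟩
    subst hxy
    have hab : (a : F) = b := smul_left_injective F x.rep_nonzero h
    rw [Units.ext hab]
  rw [himage, Set.ncard_image_of_injective _ hinj, Set.ncard_prod, Set.ncard_univ, Nat.card_units]

lemma mk_mem_pgDel {n k : ℕ} {v : Fin n → F} (hv : v ≠ 0) :
    Projectivization.mk F v hv ∈ pgDel F n k ↔ v ∉ stdSubspace F n (n - k) := by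
  rw [pgDel, Set.mem_ofPred_eq, Projectivization.submodule_mk, Submodule.span_singleton_le_iff_mem]

lemma pgCone_pgDel (n k : ℕ) :
    pgCone (pgDel F n k) = (stdSubspace F n (n - k) : Set (Fin n → F))ᶜ := by
  ext v
  constructor
  · rintro ⟨hv, h⟩
    exact (mk_mem_pgDel hv).1 h
  · intro h
    have hv : v ≠ 0 := by
      rintro rfl
      exact h (zero_mem _)
    exact ⟨hv, (mk_mem_pgDel hv).2 h⟩

lemma mem_stdSubspace {n k : ℕ} {v : Fin n → F} :
    v ∈ stdSubspace F n k ↔ ∀ i : Fin n, k ≤ i → v i = 0 := by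
  rw [stdSubspace, LinearMap.mem_ker, funext_iff]
  simp [LinearMap.funLeft_apply]

lemma card_coords_ge {n k : ℕ} (h : k ≤ n) :
    Fintype.card {i : Fin n // n - k ≤ (i : ℕ)} = k := by
  have e : {i : Fin n // n - k ≤ (i : ℕ)} ≃ Fin k :=
    { toFun := fun i => ⟨i.1 - (n - k), by have := i.1.2; have := i.2; omega⟩
      invFun := fun j => ⟨⟨j + (n - k), by have := j.2; omega⟩, by simp⟩
      left_inv := fun i => by
        ext
        have := i.2
        simp only
        omega
      right_inv := fun j => by
        ext
        simp }
  rw [Fintype.card_congr e, Fintype.card_fin]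

lemma finrank_stdSubspace {n k : ℕ} (h : k ≤ n) :
    Module.finrank F (stdSubspace F n (n - k)) = n - k := by
  have h1 := LinearMap.finrank_range_add_finrank_ker
    (LinearMap.funLeft F F (fun i : {i : Fin n // n - k ≤ (i : ℕ)} => (i : Fin n)))
  rw [LinearMap.range_eq_top.2 (LinearMap.funLeft_surjective_of_injective _ _ _
    Subtype.val_injective), finrank_top, Module.finrank_fintype_fun_eq_card,
    Module.finrank_fintype_fun_eq_card, card_coords_ge h, Fintype.card_fin] at h1
  rw [stdSubspace]
  omega

lemma finrank_comap_stdSubspace {m n k : ℕ} (h : k ≤ n) (f : (Fin m → F) →ₗ[F] (Fin n → F)) :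
    m - k ≤ Module.finrank F ((stdSubspace F n (n - k)).comap f) := by
  have h1 := LinearMap.finrank_range_add_finrank_ker
    (LinearMap.funLeft F F (fun i : {i : Fin n // n - k ≤ (i : ℕ)} => (i : Fin n)) ∘ₗ f)
  have h2 := Submodule.finrank_le (LinearMap.range
    (LinearMap.funLeft F F (fun i : {i : Fin n // n - k ≤ (i : ℕ)} => (i : Fin n)) ∘ₗ f))
  rw [Module.finrank_fintype_fun_eq_card, card_coords_ge h] at h2
  rw [Module.finrank_fintype_fun_eq_card, Fintype.card_fin, LinearMap.ker_comp] at h1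
  rw [stdSubspace]
  omega

lemma PGContains.trans {l m n : ℕ} {H : Set (Projectivization F (Fin l → F))}
    {K : Set (Projectivization F (Fin m → F))} {M : Set (Projectivization F (Fin n → F))}
    (h₁ : PGContains F l m H K) (h₂ : PGContains F m n K M) : PGContains F l n H M := by
  obtain ⟨f, hf, hfH⟩ := h₁
  obtain ⟨g, hg, hgK⟩ := h₂
  refine ⟨g ∘ₗ f, hg.comp hf, fun x hx => ?_⟩
  rw [Projectivization.map_comp f hf g hg]
  exact hgK _ (hfH x hx)

/-- A geometry contained in `G(n-1,q,k)` is already contained in `G(m-1,q,k)`. -/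
lemma PGContains.pgDel_of_pgDel {m n k : ℕ} (hkm : k ≤ m) (hkn : k ≤ n)
    {H : Set (Projectivization F (Fin m → F))} (h : PGContains F m n H (pgDel F n k)) :
    PGContains F m m H (pgDel F m k) := by
  obtain ⟨f, hf, hH⟩ := h
  obtain ⟨b, hb⟩ := exists_linearIndependent_of_le_finrank (finrank_comap_stdSubspace hkn f)
  have hb' := hb.map' _ (Submodule.ker_subtype _)
  set U := Submodule.span F (Set.range (Submodule.subtype _ ∘ b)) with hU
  have hUle : U ≤ (stdSubspace F n (n - k)).comap f := by
    rw [hU, Submodule.span_le]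
    rintro _ ⟨i, rfl⟩
    exact (b i).2
  have hrank : Module.finrank F U = Module.finrank F (stdSubspace F m (m - k)) := by
    rw [finrank_span_eq_card hb', Fintype.card_fin, finrank_stdSubspace hkm]
  obtain ⟨g, hg⟩ := Submodule.exists_linearEquiv_restrict_eq (LinearEquiv.ofFinrankEq _ _ hrank)
  refine ⟨g.toLinearMap, g.injective, fun x hx => ?_⟩
  induction x using Projectivization.ind with | h v hv =>
  have h1 := hH _ hx
  rw [Projectivization.map_mk, mk_mem_pgDel] at h1
  rw [Projectivization.map_mk, mk_mem_pgDel]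
  intro h2
  apply h1
  have h3 := hg ((LinearEquiv.ofFinrankEq _ _ hrank).symm ⟨_, h2⟩)
  rw [LinearEquiv.apply_symm_apply] at h3
  have h4 : v = _ := g.injective h3
  exact hUle (h4 ▸ Subtype.coe_prop _)

lemma pgContains_pgDel_self (m : ℕ) (H : Set (Projectivization F (Fin m → F))) :
    PGContains F m m H (pgDel F m m) := by
  refine ⟨LinearMap.id, Function.injective_id, fun x _ => ?_⟩
  induction x using Projectivization.ind with | h v hv =>
  rw [Projectivization.map_mk, mk_mem_pgDel, mem_stdSubspace]
  intro h
  exact hv (funext fun i => h i (by simp))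

lemma pgRank_le (m : ℕ) (H : Set (Projectivization F (Fin m → F))) : pgRank F m H ≤ m := by
  simpa [pgRank] using Submodule.finrank_le (⨆ x ∈ H, x.submodule)

/-- A positive critical exponent `c` is at most the dimension of the ambient space, and is the
least `c` for which the geometry is contained in `G(m-1,q,c)`. -/
lemma critExp_spec {m c : ℕ} {H : Set (Projectivization F (Fin m → F))} (hc : 0 < c)
    (hcrit : critExp F m H = c) : c ≤ m ∧ PGContains F m m H (pgDel F m c) ∧
      ∀ k < c, ¬ PGContains F m m H (pgDel F m k) := by
  have hne := Nat.nonempty_of_pos_sInf (hc.trans_eq hcrit.symm)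
  have hr : pgRank F m H = m := by
    obtain ⟨_, f, hf, -⟩ := hne
    refine le_antisymm (pgRank_le m H) ?_
    simpa using LinearMap.finrank_le_finrank_of_injective hf
  rw [critExp, hr] at hcrit
  rw [hr] at hne
  subst hcrit
  exact ⟨Nat.sInf_le (pgContains_pgDel_self m H), Nat.sInf_mem hne,
    fun k hk => Nat.notMem_of_lt_sInf hk⟩

variable [Fintype F]

lemma ncard_pgDel {n k : ℕ} (h : k ≤ n) :
    ((pgDel F n k).ncard : ℝ) * (Fintype.card F - 1) =
      (1 - ((Fintype.card F : ℝ) ^ k)⁻¹) * (Fintype.card F : ℝ) ^ n := by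
  have h1 := ncard_pgCone (pgDel F n k)
  have h2 : (stdSubspace F n (n - k) : Set (Fin n → F)).ncard = Fintype.card F ^ (n - k) := by
    have h0 := Module.natCard_eq_pow_finrank (K := F) (V := stdSubspace F n (n - k))
    rw [finrank_stdSubspace h, Nat.card_eq_fintype_card (α := F)] at h0
    rw [← Nat.card_coe_set_eq]
    exact h0
  have h3 := Set.ncard_add_ncard_compl (stdSubspace F n (n - k) : Set (Fin n → F))
  have h4 : ((Fintype.card F - 1 : ℕ) : ℝ) = (Fintype.card F : ℝ) - 1 := by
    rw [Nat.cast_sub Fintype.card_pos, Nat.cast_one]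
  rw [← pgCone_pgDel, h1, h2, Nat.card_fun, Nat.card_eq_fintype_card, Nat.card_fin] at h3
  have h5 : (Fintype.card F : ℝ) ^ n =
      (Fintype.card F : ℝ) ^ (n - k) * (Fintype.card F : ℝ) ^ k := by
    rw [← pow_add]
    congr 1
    omega
  have h6 : (Fintype.card F : ℝ) ≠ 0 := by exact_mod_cast Fintype.card_ne_zero
  have h7 : (Fintype.card F : ℝ) ^ (n - k) +
      (pgDel F n k).ncard * ((Fintype.card F : ℝ) - 1) = (Fintype.card F : ℝ) ^ n := by
    rw [← h4]
    exact_mod_cast h3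
  have h8 : ((Fintype.card F : ℝ) ^ k)⁻¹ * (Fintype.card F : ℝ) ^ n =
      (Fintype.card F : ℝ) ^ (n - k) := by
    rw [h5, mul_comm, mul_inv_cancel_right₀ (pow_ne_zero _ h6)]
  linarith

/-- A dense enough geometry contains `G(m-1,q,k+1)`. -/
lemma exists_pgContains_pgDel (m k : ℕ) (hk : k + 1 ≤ m) {ε : ℝ} (hε : 0 < ε) :
    ∃ N, ∀ n, N ≤ n → ∀ M : Set (Projectivization F (Fin n → F)),
      (1 - ((Fintype.card F : ℝ) ^ k)⁻¹ + ε) * (Fintype.card F : ℝ) ^ n ≤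
        M.ncard * (Fintype.card F - 1) → PGContains F m n (pgDel F m (k + 1)) M := by
  obtain ⟨t, rfl⟩ := Nat.exists_eq_add_of_le' hk
  obtain ⟨N, hN⟩ := exists_linearMap_mem_of_dens F t k hε
  refine ⟨N, fun n hn M hM => ?_⟩
  obtain ⟨f, hf, hfM⟩ := hN n hn (pgCone M) (fun h => h.1 rfl)
    (fun a ha v ⟨hv, hvM⟩ => ⟨smul_ne_zero ha hv, by
      convert hvM using 1
      rw [Projectivization.mk_eq_mk_iff']
      exact ⟨a, rfl⟩⟩)
    (by
      have h4 : ((Fintype.card F - 1 : ℕ) : ℝ) = (Fintype.card F : ℝ) - 1 := by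
        rw [Nat.cast_sub Fintype.card_pos, Nat.cast_one]
      have h6 : (0 : ℝ) < Fintype.card F := by exact_mod_cast Fintype.card_pos
      rw [dens_eq_ncard, ncard_pgCone, Nat.card_fun, Nat.card_eq_fintype_card, Nat.card_fin,
        le_div_iff₀ (by positivity)]
      push_cast
      rwa [h4])
  let g : (Fin (t + (k + 1)) → F) →ₗ[F] (Fin t → F) × (Fin (k + 1) → F) :=
    (LinearMap.funLeft F F (Fin.castAdd (k + 1))).prod (LinearMap.funLeft F F (Fin.natAdd t))
  have hg : Function.Injective g := by
    intro x y hxy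
    ext i
    refine Fin.addCases (fun i => ?_) (fun i => ?_) i
    · exact congrFun (congrArg Prod.fst hxy) i
    · exact congrFun (congrArg Prod.snd hxy) i
  refine ⟨f ∘ₗ g, hf.comp hg, fun x hx => ?_⟩
  induction x using Projectivization.ind with | h v hv =>
  rw [mk_mem_pgDel, mem_stdSubspace] at hx
  rw [Projectivization.map_mk]
  have h1 : (g v).2 ≠ 0 := fun h => hx fun i hi => by
    have h2 := congrFun h ⟨i - t, by omega⟩
    refine Eq.trans (congrArg v ?_) h2
    ext
    simp
    omega
  exact (hfM (g v).1 (g v).2 h1).2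

end Geometry

/-- If `H` is a geometry over a finite field `F` of order `q` with critical exponent `c > 0`,
then `ex_q(H; n) / |PG(n-1,q)| → 1 - q^(1-c)` as `n → ∞`. -/
theorem critical_exponent_limit (F : Type) [Field F] [Fintype F]
    (m : ℕ) (H : Set (Projectivization F (Fin m → F)))
    (c : ℕ) (hc : 0 < c) (hcrit : critExp F m H = c) :
    Filter.Tendsto
      (fun n : ℕ => (pgEx F m H n : ℝ) /
        (((Fintype.card F : ℝ) ^ n - 1) / ((Fintype.card F : ℝ) - 1)))
      Filter.atTop (nhds (1 - (Fintype.card F : ℝ) ^ (1 - (c : ℤ)))) := by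
  obtain ⟨hcm, hcon, hmin⟩ := critExp_spec hc hcrit
  obtain ⟨k, rfl⟩ : ∃ k, c = k + 1 := ⟨c - 1, by omega⟩
  have hq : (1 : ℝ) < Fintype.card F := by exact_mod_cast Fintype.one_lt_card
  have hexp : (Fintype.card F : ℝ) ^ (1 - ((k + 1 : ℕ) : ℤ)) = ((Fintype.card F : ℝ) ^ k)⁻¹ := by
    rw [← zpow_natCast, ← zpow_neg]
    congr 1
    push_cast
    ring
  rw [hexp]
  set q : ℝ := (Fintype.card F : ℝ)
  have hfree : ∀ n, k ≤ n → ¬ PGContains F m n H (pgDel F n k) := fun n hn h =>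
    hmin k (by omega) (h.pgDel_of_pgDel (by omega) hn)
  have hbdd : ∀ n, BddAbove {l | ∃ M : Set (Projectivization F (Fin n → F)),
      ¬ PGContains F m n H M ∧ M.ncard = l} := fun n =>
    ⟨Nat.card (Projectivization F (Fin n → F)), by
      rintro _ ⟨M, -, rfl⟩
      exact Set.ncard_le_card M⟩
  have hL : 0 ≤ 1 - (q ^ k)⁻¹ := sub_nonneg.2 (inv_le_one_of_one_le₀ (one_le_pow₀ hq.le))
  have hlower : ∀ n, k ≤ n → (1 - (q ^ k)⁻¹) * q ^ n ≤ pgEx F m H n * (q - 1) := fun n hn => by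
    rw [← ncard_pgDel hn]
    gcongr
    exact le_csSup (hbdd n) ⟨_, hfree n hn, rfl⟩
  rw [tendsto_order]
  constructor
  · intro b hb
    filter_upwards [Filter.eventually_ge_atTop (k + 1)] with n hn
    have h1 : 1 < q ^ n := one_lt_pow₀ hq (by omega)
    rw [div_div_eq_mul_div, lt_div_iff₀ (by linarith)]
    have := hlower n (by omega)
    nlinarith
  · intro b hb
    obtain ⟨N, hN⟩ := exists_pgContains_pgDel (F := F) m k hcm (half_pos (sub_pos.2 hb))
    have hlim : ∀ᶠ n : ℕ in Filter.atTop, b ≤ (b - (1 - (q ^ k)⁻¹)) / 2 * q ^ n :=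
      ((tendsto_pow_atTop_atTop_of_one_lt hq).const_mul_atTop
        (half_pos (sub_pos.2 hb))).eventually_ge_atTop b
    filter_upwards [Filter.eventually_ge_atTop (k + 1), Filter.eventually_ge_atTop N, hlim]
      with n hn hnN hnb
    have h1 : 1 < q ^ n := one_lt_pow₀ hq (by omega)
    obtain ⟨M, hM, hMcard⟩ : pgEx F m H n ∈ {l | ∃ M : Set (Projectivization F (Fin n → F)),
        ¬ PGContains F m n H M ∧ M.ncard = l} := by
      refine Nat.sSup_mem ?_ (hbdd n)
      exact ⟨_, _, hfree n (by omega), rfl⟩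
    have h2 : M.ncard * (q - 1) < (1 - (q ^ k)⁻¹ + (b - (1 - (q ^ k)⁻¹)) / 2) * q ^ n := by
      by_contra! h
      exact hM (hcon.trans (hN n hnN M h))
    rw [div_div_eq_mul_div, div_lt_iff₀ (by linarith), ← hMcard]
    linarith
end

section
/- Let q be a prime power and let n ≥ m ≥ 1 be integers. Then ex_q(PG(m-1,q); n) = (q^n - q^{n-m+1})/(q-1); that is, the maximum size of a set of points of PG(n-1,q) containing no copy of PG(m-1,q) equals the number of points of PG(n-1,q) outside a rank-(n-m+1) flat. -/
/-- The nonzero vectors representing a point of `M`. -/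
def Projectivization.cone {F V : Type*} [DivisionRing F] [AddCommGroup V] [Module F V]
    (M : Set (Projectivization F V)) : Set V :=
  {v | ∃ h : v ≠ 0, Projectivization.mk F v h ∈ M}

/-- Every point has `q - 1` nonzero representatives. -/
theorem Projectivization.ncard_cone {F V : Type*} [Field F] [Fintype F] [AddCommGroup V]
    [Module F V] (M : Set (Projectivization F V)) :
    (Projectivization.cone M).ncard = M.ncard * (Fintype.card F - 1) := by
  classical
  have h : Function.Bijective
      (fun x : M × Fˣ => (⟨x.2 • x.1.1.rep, by
        have h0 : x.2 • x.1.1.rep ≠ 0 := (smul_ne_zero_iff_ne x.2).2 x.1.1.rep_nonzero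
        refine ⟨h0, ?_⟩
        have : Projectivization.mk F (x.2 • x.1.1.rep) h0 = x.1.1 := by
          conv_rhs => rw [← x.1.1.mk_rep]
          rw [Projectivization.mk_eq_mk_iff]
          exact ⟨x.2, rfl⟩
        rw [this]
        exact x.1.2⟩ : Projectivization.cone M)) := by
    constructor
    · rintro ⟨⟨p, hp⟩, a⟩ ⟨⟨r, hr⟩, b⟩ hab
      have hab : a • p.rep = b • r.rep := congrArg Subtype.val hab
      obtain rfl : p = r := by
        rw [← p.mk_rep, ← r.mk_rep, Projectivization.mk_eq_mk_iff]
        exact ⟨a⁻¹ * b, by rw [mul_smul, ← hab, inv_smul_smul]⟩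
      have : (a : F) = b := smul_left_injective F p.rep_nonzero hab
      rw [Units.ext this]
    · rintro ⟨v, h0, hv⟩
      obtain ⟨a, ha⟩ := Projectivization.exists_smul_eq_mk_rep F v h0
      exact ⟨⟨⟨_, hv⟩, a⁻¹⟩, Subtype.ext (by simp [← ha])⟩
  rw [← Nat.card_coe_set_eq, ← Nat.card_eq_of_bijective _ h, Nat.card_prod,
    Nat.card_coe_set_eq, Nat.card_units, Nat.card_eq_fintype_card]

/-- A set `T` containing zero and closed under scaling with fewer than `q ^ (n - d + 1)` vectors
meets some subspace of dimension `d` only in the zero vector. -/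
theorem exists_submodule_finrank_eq_inter_trivial {F V : Type*} [Field F] [Fintype F]
    [AddCommGroup V] [Module F V] [FiniteDimensional F V] {T : Set V}
    (hz : 0 ∈ T) (hT : ∀ (c : F), ∀ v ∈ T, c • v ∈ T) {d : ℕ} (hd : d ≤ Module.finrank F V)
    (hcard : T.ncard < Fintype.card F ^ (Module.finrank F V - d + 1)) :
    ∃ U : Submodule F V, Module.finrank F U = d ∧ ∀ v ∈ U, v ∈ T → v = 0 := by
  have : Finite V := Module.finite_of_finite F
  induction d with
  | zero => exact ⟨⊥, finrank_bot F V, fun v hv _ => (Submodule.mem_bot F).1 hv⟩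
  | succ j ih =>
    have hq : 0 < Fintype.card F := Fintype.card_pos
    obtain ⟨U, hU, hUT⟩ := ih (by omega)
      (hcard.trans_le (Nat.pow_le_pow_right hq (by omega)))
    obtain ⟨v, hv⟩ : ∃ v : V, v ∉ Set.image2 (· + ·) (U : Set V) T := by
      by_contra! hall
      have h1 : Nat.card V ≤ (U : Set V).ncard * T.ncard := by
        rw [← Set.ncard_univ, ← Set.eq_univ_of_forall hall, ← Set.image_prod,
          ← Set.ncard_prod]
        exact Set.ncard_image_le (Set.toFinite _)
      have h2 : (U : Set V).ncard = Fintype.card F ^ j := by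
        rw [← Nat.card_coe_set_eq]
        change Nat.card U = _
        rw [Module.natCard_eq_pow_finrank (K := F), hU, Nat.card_eq_fintype_card]
      rw [h2, Module.natCard_eq_pow_finrank (K := F), Nat.card_eq_fintype_card] at h1
      have h3 : Fintype.card F ^ j * T.ncard <
          Fintype.card F ^ j * Fintype.card F ^ (Module.finrank F V - (j + 1) + 1) :=
        Nat.mul_lt_mul_of_pos_left hcard (by positivity)
      rw [← pow_add, show j + (Module.finrank F V - (j + 1) + 1) = Module.finrank F V by omega]
        at h3
      omega
    have hvU : v ∉ U := fun h => hv ⟨v, h, 0, hz, add_zero v⟩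
    refine ⟨U ⊔ Submodule.span F {v}, ?_, ?_⟩
    · have hdis : U ⊓ Submodule.span F {v} = ⊥ :=
        (Submodule.disjoint_span_singleton_of_notMem hvU).eq_bot
      have := Submodule.finrank_sup_add_finrank_inf_eq U (Submodule.span F {v})
      rw [hdis, finrank_bot, hU,
        finrank_span_singleton (fun h => hvU (h ▸ U.zero_mem) : v ≠ 0)] at this
      omega
    · intro w hw hwT
      obtain ⟨u, hu, x, hx, rfl⟩ := Submodule.mem_sup.1 hw
      obtain ⟨c, rfl⟩ := Submodule.mem_span_singleton.1 hx
      by_cases hc : c = 0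
      · subst hc
        simp only [zero_smul, add_zero] at hwT ⊢
        exact hUT u hu hwT
      · refine absurd ⟨-(c⁻¹ • u), U.neg_mem (U.smul_mem _ hu), c⁻¹ • (u + c • v),
          hT _ _ hwT, ?_⟩ hv
        simp [smul_add, smul_smul, hc]

/-- Containment of the full geometry means containment of all points of a rank-`m` subspace. -/
theorem pgContains_univ_iff {F : Type} [Field F] {m n : ℕ}
    {M : Set (Projectivization F (Fin n → F))} :
    PGContains F m n Set.univ M ↔ ∃ U : Submodule F (Fin n → F), Module.finrank F U = m ∧
      ∀ v ∈ U, v ≠ 0 → v ∈ Projectivization.cone M := by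
  constructor
  · rintro ⟨f, hf, h⟩
    refine ⟨LinearMap.range f, by simp [LinearMap.finrank_range_of_inj hf], ?_⟩
    rintro _ ⟨x, rfl⟩ h0
    have hx : x ≠ 0 := by rintro rfl; exact h0 (map_zero f)
    exact ⟨h0, h (Projectivization.mk F x hx) trivial⟩
  · rintro ⟨U, hU, h⟩
    let e : (Fin m → F) ≃ₗ[F] U := LinearEquiv.ofFinrankEq _ _ (by simp [hU])
    have hf : Function.Injective (U.subtype ∘ₗ e.toLinearMap) :=
      U.injective_subtype.comp e.injective
    refine ⟨U.subtype ∘ₗ e.toLinearMap, hf, fun x _ => ?_⟩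
    induction x using Projectivization.ind with
    | h x hx =>
      obtain ⟨_, hM⟩ := h (e x) (e x).2 (by simpa using hx)
      exact hM

/-- The upper bound in the Bose–Burton theorem, counting vectors. -/
theorem ncard_cone_add_pow_le_of_not_pgContains {F : Type} [Field F] [Fintype F] {m n : ℕ}
    (hmn : m ≤ n) {M : Set (Projectivization F (Fin n → F))}
    (hM : ¬ PGContains F m n Set.univ M) :
    (Projectivization.cone M).ncard + Fintype.card F ^ (n - m + 1) ≤ Fintype.card F ^ n := by
  classical
  have hcompl := Set.ncard_add_ncard_compl (Projectivization.cone M)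
  rw [Nat.card_eq_fintype_card, Fintype.card_fun, Fintype.card_fin] at hcompl
  by_contra! hlt
  have hsmul : ∀ (c : F), ∀ v ∈ (Projectivization.cone M)ᶜ,
      c • v ∈ (Projectivization.cone M)ᶜ := by
    rintro c v hv ⟨h0, hcM⟩
    have hc : c ≠ 0 := left_ne_zero_of_smul h0
    refine hv ⟨right_ne_zero_of_smul h0, ?_⟩
    convert hcM using 1
    rw [Projectivization.mk_eq_mk_iff']
    exact ⟨c⁻¹, inv_smul_smul₀ hc v⟩
  obtain ⟨U, hU, h⟩ := exists_submodule_finrank_eq_inter_trivial (d := m)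
    (T := (Projectivization.cone M)ᶜ)
    (fun h : 0 ∈ Projectivization.cone M => h.1 rfl) hsmul (by simpa using hmn)
    (by rw [Module.finrank_fin_fun]; omega)
  exact hM (pgContains_univ_iff.2 ⟨U, hU, fun v hv h0 => by_contra fun hn => h0 (h v hv hn)⟩)

/-- The complement of a rank-`(n - m + 1)` flat contains no copy of `PG(m-1,q)` and attains the
Bose–Burton bound. -/
theorem exists_not_pgContains_ncard_cone_add_pow_eq (F : Type) [Field F] [Fintype F] {m n : ℕ}
    (hm : 1 ≤ m) (hmn : m ≤ n) :
    ∃ M : Set (Projectivization F (Fin n → F)), ¬ PGContains F m n Set.univ M ∧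
      (Projectivization.cone M).ncard + Fintype.card F ^ (n - m + 1) = Fintype.card F ^ n := by
  classical
  obtain ⟨W, hW, -⟩ := exists_submodule_finrank_eq_inter_trivial (F := F) (V := Fin n → F)
    (T := {0}) (d := n - m + 1) rfl (by simp) (by rw [Module.finrank_fin_fun]; omega) (by
      rw [Set.ncard_singleton]
      exact Nat.one_lt_pow (by omega) Fintype.one_lt_card)
  have hcone : Projectivization.cone (pgFlat F n W)ᶜ = (W : Set (Fin n → F))ᶜ := by
    ext v
    simp only [Projectivization.cone, pgFlat, Set.mem_compl_iff, Set.mem_ofPred_eq,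
      Projectivization.submodule_mk, Submodule.span_singleton_le_iff_mem, SetLike.mem_coe,
      exists_prop, and_iff_right_iff_imp]
    rintro hv rfl
    exact hv W.zero_mem
  refine ⟨(pgFlat F n W)ᶜ, fun h => ?_, ?_⟩
  · obtain ⟨U, hU, h⟩ := pgContains_univ_iff.1 h
    rw [hcone] at h
    have hdis : Disjoint U W := by
      rw [Submodule.disjoint_def]
      exact fun v hvU hvW => by_contra fun h0 => h v hvU h0 hvW
    have := Submodule.finrank_add_finrank_le_of_disjoint hdis
    rw [hU, hW, Module.finrank_fin_fun] at this
    omega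
  · have hcompl := Set.ncard_add_ncard_compl (W : Set (Fin n → F))
    have h2 : (W : Set (Fin n → F)).ncard = Fintype.card F ^ (n - m + 1) := by
      rw [← Nat.card_coe_set_eq]
      change Nat.card W = _
      rw [Module.natCard_eq_pow_finrank (K := F), hW, Nat.card_eq_fintype_card]
    rw [h2, Nat.card_eq_fintype_card, Fintype.card_fun, Fintype.card_fin] at hcompl
    rw [hcone, add_comm, hcompl]

/-- **Bose–Burton theorem.** For `n ≥ m ≥ 1`,
`ex_q(PG(m-1,q); n) = (q^n - q^(n-m+1))/(q-1)`. -/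
theorem bose_burton (F : Type) [Field F] [Fintype F]
    (m n : ℕ) (hm : 1 ≤ m) (hmn : m ≤ n) :
    (pgEx F m (Set.univ : Set (Projectivization F (Fin m → F))) n : ℝ) =
      ((Fintype.card F : ℝ) ^ n - (Fintype.card F : ℝ) ^ (n - m + 1)) /
        ((Fintype.card F : ℝ) - 1) := by
  have hq : 1 < Fintype.card F := Fintype.one_lt_card
  obtain ⟨M, hM, hcard⟩ := exists_not_pgContains_ncard_cone_add_pow_eq F hm hmn
  have hgreatest : IsGreatest {k | ∃ M : Set (Projectivization F (Fin n → F)),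
      ¬ PGContains F m n Set.univ M ∧ M.ncard = k} M.ncard := by
    refine ⟨⟨M, hM, rfl⟩, ?_⟩
    rintro _ ⟨N, hN, rfl⟩
    have hle := ncard_cone_add_pow_le_of_not_pgContains hmn hN
    rw [← hcard, add_le_add_iff_right, Projectivization.ncard_cone,
      Projectivization.ncard_cone] at hle
    exact Nat.le_of_mul_le_mul_right hle (by omega)
  rw [pgEx, hgreatest.csSup_eq]
  rw [Projectivization.ncard_cone] at hcard
  have hcast : (M.ncard : ℝ) * ((Fintype.card F : ℝ) - 1) + (Fintype.card F : ℝ) ^ (n - m + 1) =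
      (Fintype.card F : ℝ) ^ n := by
    rw [← Nat.cast_one, ← Nat.cast_sub hq.le]
    exact_mod_cast hcard
  rw [eq_div_iff (sub_ne_zero.2 (by exact_mod_cast hq.ne')), ← hcast, add_sub_cancel_right]
end
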